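/- arXiv:2007.03493 — 4 statements merged into one kernel-verified Lean document; each statement's English description precedes it below -/
import Mathlib

section
/- Let d ≥ 1 and n ≥ 2 be integers, let E ⊆ ℝ^d be a Lebesgue-measurable set whose upper Banach density ρ(E) is strictly greater than (n-1)/n, and let P ⊆ ℝ^d be a set of n points. Then for every r > 0 there exists z ∈ ℝ^d such that r•P + z ⊆ E, i.e., E contains a translated copy of rP. -/
open MeasureTheory Filter

/-- The upper Banach density of a set `E ⊆ ℝ^d`:
`ρ(E) = limsup_{r→∞} sup_{x} 𝓛^d(E ∩ B_r(x)) / 𝓛^d(B_r(x))`. -/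
noncomputable def upperBanachDensity (d : ℕ) (E : Set (EuclideanSpace ℝ (Fin d))) : ENNReal :=
  Filter.limsup (fun r : ℝ => ⨆ x : EuclideanSpace ℝ (Fin d),
    volume (E ∩ Metric.closedBall x r) / volume (Metric.closedBall x r)) Filter.atTop

section Translates

variable {V : Type*} [NormedAddCommGroup V] [MeasurableSpace V] [BorelSpace V]
  [NormedSpace ℝ V] [FiniteDimensional ℝ V] (μ : Measure V) [μ.IsAddHaarMeasure]

/-- If `E` contains no translate of `F`, then the complement of `E` takes up at least a proportion
of about `1 / #F` of every ball. -/
theorem measureReal_closedBall_le_card_mul_of_forall_exists_notMem {E : Set V} {F : Finset V}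
    {M : ℝ} (hM : ∀ p ∈ F, ‖p‖ ≤ M) (hF : ∀ z, ∃ p ∈ F, p + z ∉ E) (x : V) (R : ℝ) :
    μ.real (Metric.closedBall x R) ≤ F.card * μ.real (Metric.closedBall x (R + M) \ E) := by
  have hfin : μ (Metric.closedBall x (R + M) \ E) ≠ ⊤ :=
    ((measure_mono Set.sdiff_subset).trans_lt measure_closedBall_lt_top).ne
  have hcover : Metric.closedBall x R ⊆
      ⋃ p ∈ F, (p + ·) ⁻¹' (Metric.closedBall x (R + M) \ E) := by
    intro z hz
    obtain ⟨p, hp, hpz⟩ := hF z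
    refine Set.mem_biUnion hp ⟨?_, hpz⟩
    rw [mem_closedBall_iff_norm] at hz ⊢
    calc ‖p + z - x‖ = ‖(z - x) + p‖ := by congr 1; abel
      _ ≤ ‖z - x‖ + ‖p‖ := norm_add_le _ _
      _ ≤ R + M := add_le_add hz (hM p hp)
  have hpre (p : V) : μ ((p + ·) ⁻¹' (Metric.closedBall x (R + M) \ E)) =
      μ (Metric.closedBall x (R + M) \ E) := measure_preimage_add μ p _
  calc μ.real (Metric.closedBall x R)
      ≤ μ.real (⋃ p ∈ F, (p + ·) ⁻¹' (Metric.closedBall x (R + M) \ E)) := by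
        refine measureReal_mono hcover (ne_of_lt ?_)
        refine (measure_biUnion_finset_le F _).trans_lt (ENNReal.sum_lt_top.2 fun p _ => ?_)
        rw [hpre]
        exact hfin.lt_top
    _ ≤ ∑ p ∈ F, μ.real ((p + ·) ⁻¹' (Metric.closedBall x (R + M) \ E)) :=
        measureReal_biUnion_finset_le F _
    _ = F.card * μ.real (Metric.closedBall x (R + M) \ E) := by
        simp only [measureReal_def, hpre, Finset.sum_const, nsmul_eq_mul]

/-- If `E` contains no translate of `F`, then the density of `E` in every large ball is at most
about `1 - 1 / #F`. -/
theorem measure_inter_closedBall_div_le_of_forall_exists_notMem {E : Set V} (hE : MeasurableSet E)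
    {F : Finset V} {M : ℝ} (hM : ∀ p ∈ F, ‖p‖ ≤ M) (hF : ∀ z, ∃ p ∈ F, p + z ∉ E) (x : V) {S : ℝ}
    (hS : 0 < S) (hMS : M ≤ S) :
    μ (E ∩ Metric.closedBall x S) / μ (Metric.closedBall x S) ≤
      ENNReal.ofReal (1 - (1 - M / S) ^ Module.finrank ℝ V / F.card) := by
  have hcard : (0 : ℝ) < F.card := by
    obtain ⟨p, hp, -⟩ := hF 0
    exact_mod_cast Finset.card_pos.2 ⟨p, hp⟩
  have hball {t : ℝ} (ht : 0 ≤ t) : μ.real (Metric.closedBall x t) =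
      t ^ Module.finrank ℝ V * μ.real (Metric.ball 0 1) := by
    rw [measureReal_def, Measure.addHaar_closedBall μ x ht, ENNReal.toReal_mul,
      ENNReal.toReal_ofReal (pow_nonneg ht _), measureReal_def]
  have hpos : 0 < μ.real (Metric.closedBall x S) :=
    ENNReal.toReal_pos (Metric.measure_closedBall_pos μ x hS).ne' measure_closedBall_lt_top.ne
  have hcompl := measureReal_closedBall_le_card_mul_of_forall_exists_notMem μ hM hF x (S - M)
  rw [sub_add_cancel] at hcompl
  have hscale : μ.real (Metric.closedBall x (S - M)) =
      (1 - M / S) ^ Module.finrank ℝ V * μ.real (Metric.closedBall x S) := by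
    rw [hball (sub_nonneg.2 hMS), hball hS.le, ← mul_assoc, ← mul_pow]
    congr 2
    field_simp
  have hsplit := measureReal_inter_add_sdiff (μ := μ) (s := Metric.closedBall x S) hE
    measure_closedBall_lt_top.ne
  rw [Set.inter_comm] at hsplit
  have hinter : μ (E ∩ Metric.closedBall x S) ≠ ⊤ :=
    ((measure_mono Set.inter_subset_right).trans_lt measure_closedBall_lt_top).ne
  rw [← ofReal_measureReal hinter,
    ← ofReal_measureReal (measure_closedBall_lt_top (μ := μ) (x := x) (r := S)).ne,
    ← ENNReal.ofReal_div_of_pos hpos]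
  refine ENNReal.ofReal_le_ofReal ((div_le_iff₀ hpos).2 ?_)
  rw [sub_mul, one_mul, div_mul_eq_mul_div, ← hscale]
  have := (div_le_iff₀' hcard).2 hcompl
  linarith

end Translates

/-- A measurable set without a translate of the finite set `F` has upper Banach density at most
`1 - 1 / #F`. -/
theorem upperBanachDensity_le_of_forall_exists_notMem {d : ℕ}
    {E : Set (EuclideanSpace ℝ (Fin d))} (hE : MeasurableSet E)
    {F : Finset (EuclideanSpace ℝ (Fin d))} (hF : ∀ z, ∃ p ∈ F, p + z ∉ E) :
    upperBanachDensity d E ≤ ENNReal.ofReal (1 - 1 / F.card) := by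
  obtain ⟨M, hM⟩ := F.finite_toSet.isBounded.exists_norm_le
  have htendsto : Tendsto (fun S : ℝ => ENNReal.ofReal
      (1 - (1 - M / S) ^ Module.finrank ℝ (EuclideanSpace ℝ (Fin d)) / F.card)) atTop
      (nhds (ENNReal.ofReal (1 - 1 / F.card))) := by
    refine ENNReal.tendsto_ofReal (Tendsto.const_sub 1 (Tendsto.div_const ?_ _))
    simpa using ((tendsto_const_nhds (x := M).div_atTop tendsto_id).const_sub 1).pow
      (Module.finrank ℝ (EuclideanSpace ℝ (Fin d)))
  rw [← htendsto.limsup_eq]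
  refine limsup_le_limsup ?_
  filter_upwards [eventually_gt_atTop 0, eventually_ge_atTop M] with S hS hMS
  exact iSup_le fun x =>
    measure_inter_closedBall_div_le_of_forall_exists_notMem volume hE hM hF x hS hMS

/-- If `E ⊆ ℝ^d` is measurable with upper Banach density strictly greater than `(n-1)/n`
and `P` is an `n`-point set, then for every `r > 0` the set `E` contains a translated copy
of `r • P`. -/
theorem density_gt_implies_translate (d n : ℕ) (hd : 1 ≤ d) (hn : 2 ≤ n)
    (E : Set (EuclideanSpace ℝ (Fin d))) (hE : MeasurableSet E)
    (hρ : ((n : ENNReal) - 1) / (n : ENNReal) < upperBanachDensity d E)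
    (P : Finset (EuclideanSpace ℝ (Fin d))) (hP : P.card = n) :
    ∀ r : ℝ, 0 < r → ∃ z : EuclideanSpace ℝ (Fin d), ∀ p ∈ P, r • p + z ∈ E := by
  intro r hr
  by_contra! hno
  have hcard : (P.image (r • ·)).card = n := by
    rw [Finset.card_image_of_injective _ (smul_right_injective _ hr.ne'), hP]
  have hle := upperBanachDensity_le_of_forall_exists_notMem hE (F := P.image (r • ·))
    (by simpa using hno)
  have hn0 : (0 : ℝ) < n := by positivity
  have hconst : ENNReal.ofReal (1 - 1 / n) = ((n : ENNReal) - 1) / n := by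
    rw [one_sub_div hn0.ne', ENNReal.ofReal_div_of_pos hn0, ENNReal.ofReal_sub _ zero_le_one]
    simp
  rw [hcard, hconst] at hle
  exact hle.not_gt hρ
end

section
/- Let d ≥ 2 and n ≥ 2 be integers and 0 < S ≤ D. Let E ⊆ ℝ^d be a Lebesgue-measurable set whose upper Banach density ρ(E) is strictly greater than (n-2)/(n-1). Then there exists R > 0 (depending only on E, S, D, n) such that for every n-point pattern P ⊆ ℝ^d satisfying S ≤ sep P ≤ diam P ≤ D and every r ≥ R, there exist z ∈ ℝ^d and a rotation Q ∈ SO(d) such that r•Q(P) + z ⊆ E; that is, E contains a similar copy of P at every scale at least R. -/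
open MeasureTheory Filter

/-- A rotation of `ℝ^d` about the origin: a linear isometry with determinant `1`,
i.e. an element of `SO(d)`. -/
def IsRotation {d : ℕ}
    (Q : EuclideanSpace ℝ (Fin d) ≃ₗᵢ[ℝ] EuclideanSpace ℝ (Fin d)) : Prop :=
  LinearMap.det Q.toLinearEquiv.toLinearMap = 1

section RotationAverages

open Set Module Topology
open scoped ENNReal

/-- A bi-invariant probability measure on a group that acts on a Euclidean space by rotations,
transitively on spheres. -/
structure IsRotationFamily {d : ℕ} {G : Type*} [Group G] [MeasurableSpace G] (μ : Measure G)
    (φ : G →* (EuclideanSpace ℝ (Fin d) ≃ₗᵢ[ℝ] EuclideanSpace ℝ (Fin d))) : Prop where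
  prob : IsProbabilityMeasure μ
  mul_left : ∀ g : G, MeasurePreserving (fun h => g * h) μ μ
  mul_right : ∀ g : G, MeasurePreserving (fun h => h * g) μ μ
  measurable : Measurable fun p : G × EuclideanSpace ℝ (Fin d) => φ p.1 p.2
  rotation : ∀ g : G, IsRotation (φ g)
  transitive : ∀ v w : EuclideanSpace ℝ (Fin d), ‖v‖ = ‖w‖ → ∃ g : G, φ g v = w

lemma exists_isRotation_map_eq {d : ℕ} (hd : 2 ≤ d) {v w : EuclideanSpace ℝ (Fin d)}
    (hvw : ‖v‖ = ‖w‖) :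
    ∃ Q : EuclideanSpace ℝ (Fin d) ≃ₗᵢ[ℝ] EuclideanSpace ℝ (Fin d),
      IsRotation Q ∧ Q v = w := by
  by_cases h : v = w
  · refine ⟨LinearIsometryEquiv.refl ℝ _, ?_, h⟩
    exact LinearMap.det_id
  have hdet : ∀ u : EuclideanSpace ℝ (Fin d), u ≠ 0 →
      LinearMap.det ((ℝ ∙ u)ᗮ.reflection.toLinearEquiv.toLinearMap) = -1 := by
    intro u hu
    have := (ℝ ∙ u)ᗮ.det_reflection
    rw [Submodule.orthogonal_orthogonal, finrank_span_singleton hu, pow_one] at this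
    exact this
  obtain ⟨u, hu, hu0⟩ : ∃ u ∈ (ℝ ∙ w)ᗮ, u ≠ 0 := by
    apply Submodule.exists_mem_ne_zero_of_ne_bot
    intro hbot
    have h1 := (ℝ ∙ w).finrank_add_finrank_orthogonal
    rw [hbot, finrank_bot, finrank_euclideanSpace_fin] at h1
    have h2 := finrank_span_le_card (R := ℝ) ({w} : Set (EuclideanSpace ℝ (Fin d)))
    simp at h2
    omega
  refine ⟨(ℝ ∙ (v - w))ᗮ.reflection.trans (ℝ ∙ u)ᗮ.reflection, ?_, ?_⟩
  · have hcomp : (((ℝ ∙ (v - w))ᗮ.reflection.trans (ℝ ∙ u)ᗮ.reflection).toLinearEquiv.toLinearMap)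
        = (ℝ ∙ u)ᗮ.reflection.toLinearEquiv.toLinearMap ∘ₗ
          (ℝ ∙ (v - w))ᗮ.reflection.toLinearEquiv.toLinearMap := rfl
    rw [IsRotation, hcomp, LinearMap.det_comp, hdet u hu0, hdet _ (sub_ne_zero.2 h)]
    norm_num
  · rw [LinearIsometryEquiv.trans_apply, Submodule.reflection_sub hvw]
    apply Submodule.reflection_mem_subspace_eq_self
    rw [Submodule.mem_orthogonal_singleton_iff_inner_right] at hu ⊢
    rw [real_inner_comm, hu]

instance continuousStar_continuousLinearMap (d : ℕ) :
    ContinuousStar (EuclideanSpace ℝ (Fin d) →L[ℝ] EuclideanSpace ℝ (Fin d)) :=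
  ⟨ContinuousLinearMap.adjoint.continuous⟩

/-- The special orthogonal group of `ℝ^d`, as a group of unitary operators. -/
def rotationGroup (d : ℕ) :
    Subgroup (unitary (EuclideanSpace ℝ (Fin d) →L[ℝ] EuclideanSpace ℝ (Fin d))) where
  carrier := {u | ContinuousLinearMap.det u.1 = 1}
  mul_mem' {u v} hu hv := by
    have : ContinuousLinearMap.det (u * v).1 =
        ContinuousLinearMap.det u.1 * ContinuousLinearMap.det v.1 := LinearMap.det_comp _ _
    simp_all
  one_mem' := LinearMap.det_id
  inv_mem' {u} hu := by
    have : ContinuousLinearMap.det (u * u⁻¹).1 =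
        ContinuousLinearMap.det u.1 * ContinuousLinearMap.det (u⁻¹).1 := LinearMap.det_comp _ _
    have h1 : ContinuousLinearMap.det
        (1 : EuclideanSpace ℝ (Fin d) →L[ℝ] EuclideanSpace ℝ (Fin d)) = 1 := LinearMap.det_id
    simp_all

instance compactSpace_rotationGroup (d : ℕ) : CompactSpace (rotationGroup d) := by
  let f : rotationGroup d → EuclideanSpace ℝ (Fin d) →L[ℝ] EuclideanSpace ℝ (Fin d) :=
    fun u => u.1.1
  have hf : IsInducing f := IsInducing.subtypeVal.comp IsInducing.subtypeVal
  have hrange : range f = {u | ContinuousLinearMap.det u = 1} ∩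
      (unitary (EuclideanSpace ℝ (Fin d) →L[ℝ] EuclideanSpace ℝ (Fin d)) : Set _) := by
    ext u
    constructor
    · rintro ⟨v, rfl⟩
      exact ⟨v.2, v.1.2⟩
    · rintro ⟨h1, h2⟩
      exact ⟨⟨⟨u, h2⟩, h1⟩, rfl⟩
  rw [← isCompact_univ_iff, hf.isCompact_iff, image_univ, hrange]
  refine Metric.isCompact_of_isClosed_isBounded
    ((isClosed_singleton.preimage ContinuousLinearMap.continuous_det).inter isClosed_unitary) ?_
  refine (Metric.isBounded_closedBall (x := 0) (r := 1)).subset fun u hu => ?_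
  rw [mem_closedBall_zero_iff]
  exact ContinuousLinearMap.opNorm_le_bound _ zero_le_one fun x => by
    rw [one_mul, Unitary.norm_map ⟨u, hu.2⟩ x]

lemma exists_isRotationFamily (d : ℕ) (hd : 2 ≤ d) :
    ∃ (G : Type) (_ : Group G) (_ : MeasurableSpace G) (μ : Measure G)
      (φ : G →* (EuclideanSpace ℝ (Fin d) ≃ₗᵢ[ℝ] EuclideanSpace ℝ (Fin d))),
      IsRotationFamily μ φ := by
  let _ : MeasurableSpace (rotationGroup d) := borel _
  have : BorelSpace (rotationGroup d) := ⟨rfl⟩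
  have : SecondCountableTopology (rotationGroup d) :=
    (IsInducing.subtypeVal.comp IsInducing.subtypeVal).secondCountableTopology
  let μ : Measure (rotationGroup d) := Measure.haarMeasure ⊤
  have hprob : IsProbabilityMeasure μ := ⟨by
    simpa [μ] using Measure.haarMeasure_self (K₀ := (⊤ : TopologicalSpace.PositiveCompacts
      (rotationGroup d)))⟩
  refine ⟨rotationGroup d, inferInstance, inferInstance, μ,
    Unitary.linearIsometryEquiv.toMonoidHom.comp (rotationGroup d).subtype, ?_⟩
  refine ⟨hprob, fun g => measurePreserving_mul_left μ g, fun g => ⟨measurable_mul_const g, ?_⟩,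
    ?_, fun g => g.2, fun v w hvw => ?_⟩
  · have h1 : IsProbabilityMeasure (Measure.map (fun h => h * g) μ) :=
      Measure.isProbabilityMeasure_map (measurable_mul_const g).aemeasurable
    have h2 : (Measure.map (fun h => h * g) μ).IsHaarMeasure := inferInstance
    exact Measure.isHaarMeasure_eq_of_isProbabilityMeasure _ _
  · have hc : Continuous fun p : rotationGroup d × EuclideanSpace ℝ (Fin d) => p.1.1.1 p.2 := by
      fun_prop
    exact hc.measurable
  · obtain ⟨Q, hQ, hQv⟩ := exists_isRotation_map_eq hd hvw
    exact ⟨⟨Unitary.linearIsometryEquiv.symm Q, hQ⟩, hQv⟩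

lemma ae_notMem_of_ae_norm_notMem {V : Type*} [NormedAddCommGroup V] [NormedSpace ℝ V]
    [FiniteDimensional ℝ V] [Nontrivial V] [MeasurableSpace V] [BorelSpace V] (μ : Measure V)
    [μ.IsAddHaarMeasure] {B : Set ℝ} (hB : ∀ᵐ w ∂μ, ‖w‖ ∉ B) :
    ∀ᵐ t ∂volume.restrict (Ioi (0 : ℝ)), t ∉ B := by
  let f : ℝ → ℝ := B.indicator 1
  have hf : (fun w : V => f ‖w‖) =ᵐ[μ] 0 := by
    filter_upwards [hB] with w hw
    exact indicator_of_notMem hw _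
  have h_int := (integrable_fun_norm_addHaar μ (f := f)).1
    ((integrable_zero V ℝ μ).congr hf.symm)
  have hzero : ∫ t in Ioi (0 : ℝ), t ^ (finrank ℝ V - 1) • f t = 0 := by
    have h := integral_fun_norm_addHaar μ f
    rw [integral_congr_ae hf] at h
    have hball : μ.real (Metric.ball 0 1) ≠ 0 :=
      (ENNReal.toReal_pos (Metric.measure_ball_pos μ 0 one_pos).ne' measure_ball_lt_top.ne).ne'
    simpa [hball, (finrank_pos (R := ℝ) (M := V)).ne'] using h
  have hnonneg : ∀ t ∈ Ioi (0 : ℝ), 0 ≤ t ^ (finrank ℝ V - 1) • f t := fun t ht =>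
    smul_nonneg (pow_nonneg (mem_Ioi.1 ht).le _) (indicator_nonneg (fun _ _ => zero_le_one) _)
  rw [setIntegral_eq_zero_iff_of_nonneg_ae
    ((ae_restrict_iff' measurableSet_Ioi).2 (.of_forall hnonneg)) h_int] at hzero
  filter_upwards [hzero, self_mem_ae_restrict measurableSet_Ioi] with t ht ht0 htB
  simp [f, htB, (mem_Ioi.1 ht0).ne'] at ht

lemma ae_norm_sub_normalize_notMem {V : Type*} [NormedAddCommGroup V] [InnerProductSpace ℝ V]
    {B : Set ℝ} (hB : ∀ᵐ t ∂volume.restrict (Ioi (0 : ℝ)), t ∉ B) {e b : V} (he : ‖e‖ = 1)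
    (hb : b ≠ 0) (hbe : inner ℝ e b = 0) :
    ∀ᵐ a : ℝ, ‖e - ‖b + a • e‖⁻¹ • (b + a • e)‖ ∉ B := by
  let T : Set ℝ := B ∩ {t | 0 < t ∧ (1 - t ^ 2 / 2) ^ 2 < 1}
  have hT : volume T = 0 := by
    rw [ae_restrict_iff' measurableSet_Ioi] at hB
    refine measure_mono_null (fun t ht => ?_) (ae_iff.1 hB)
    simpa using ⟨ht.2.1, ht.1⟩
  let ψ : ℝ → ℝ := fun t => ‖b‖ * (1 - t ^ 2 / 2) / √(1 - (1 - t ^ 2 / 2) ^ 2)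
  have hψ : DifferentiableOn ℝ ψ T := by
    intro t ht
    have h1 : 0 < 1 - (1 - t ^ 2 / 2) ^ 2 := sub_pos.2 ht.2.2
    have h2 : √(1 - (1 - t ^ 2 / 2) ^ 2) ≠ 0 := (Real.sqrt_pos.2 h1).ne'
    refine DifferentiableAt.differentiableWithinAt ?_
    refine DifferentiableAt.div (by fun_prop) (DifferentiableAt.sqrt (by fun_prop) h1.ne') h2
  have himage := addHaar_image_eq_zero_of_differentiableOn_of_addHaar_eq_zero volume hψ hT
  refine measure_mono_null (fun a ha => ?_) himage
  simp only [mem_compl_iff, mem_ofPred_eq, not_not] at ha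
  set x : V := b + a • e with hx
  have hee : inner ℝ e e = (1 : ℝ) := by rw [real_inner_self_eq_norm_sq, he, one_pow]
  have hex : inner ℝ e x = a := by
    rw [hx, inner_add_right, inner_smul_right, hbe, hee]; ring
  have hxsq : ‖x‖ ^ 2 = ‖b‖ ^ 2 + a ^ 2 := by
    have hbe' : inner ℝ b e = (0 : ℝ) := by rw [real_inner_comm, hbe]
    rw [hx, norm_add_sq_real, inner_smul_right, hbe', norm_smul, he, Real.norm_eq_abs]
    simp
  have hb0 : 0 < ‖b‖ := norm_pos_iff.2 hb
  have hx0 : 0 < ‖x‖ := by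
    by_contra h
    have : ‖x‖ = 0 := le_antisymm (not_lt.1 h) (norm_nonneg _)
    rw [this] at hxsq
    nlinarith [sq_nonneg a, pow_pos hb0 2]
  set t : ℝ := ‖e - ‖x‖⁻¹ • x‖ with ht
  have htsq : t ^ 2 = 2 - 2 * (a / ‖x‖) := by
    rw [ht, norm_sub_sq_real, inner_smul_right, hex, he, norm_smul, norm_inv, norm_norm,
      inv_mul_cancel₀ hx0.ne']
    ring
  have hc : 1 - t ^ 2 / 2 = a / ‖x‖ := by rw [htsq]; ring
  have hc1 : 1 - (1 - t ^ 2 / 2) ^ 2 = (‖b‖ / ‖x‖) ^ 2 := by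
    rw [hc]
    field_simp
    rw [hxsq]
    ring
  have hpos : 0 < 1 - (1 - t ^ 2 / 2) ^ 2 := by rw [hc1]; positivity
  refine ⟨t, ⟨ha, lt_of_le_of_ne (norm_nonneg _) fun h => ?_, by linarith⟩, ?_⟩
  · rw [← h] at hpos
    norm_num at hpos
  · simp only [ψ]
    rw [hc1, hc, Real.sqrt_sq (by positivity)]
    field_simp

lemma IsRotationFamily.ae_of_norm_eq {d : ℕ} {G : Type*} [Group G] [MeasurableSpace G]
    {μ : Measure G} {φ : G →* (EuclideanSpace ℝ (Fin d) ≃ₗᵢ[ℝ] EuclideanSpace ℝ (Fin d))}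
    (h : IsRotationFamily μ φ) {v w : EuclideanSpace ℝ (Fin d)} (hvw : ‖v‖ = ‖w‖)
    {p : EuclideanSpace ℝ (Fin d) → Prop} (hv : ∀ᵐ g ∂μ, p (φ g v)) : ∀ᵐ g ∂μ, p (φ g w) := by
  obtain ⟨k, hk⟩ := h.transitive w v hvw.symm
  obtain ⟨k, rfl⟩ := h.transitive v w hvw
  filter_upwards [(h.mul_right k).quasiMeasurePreserving.ae hv] with g hg
  simpa using hg

/-- For almost all pairs of rotations, the difference of the images of a unit vector avoids a given
null set. -/
lemma IsRotationFamily.ae_sub_notMem {d : ℕ} (hd : 2 ≤ d) {G : Type*} [Group G]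
    [MeasurableSpace G] {μ : Measure G}
    {φ : G →* (EuclideanSpace ℝ (Fin d) ≃ₗᵢ[ℝ] EuclideanSpace ℝ (Fin d))}
    (h : IsRotationFamily μ φ) {e : EuclideanSpace ℝ (Fin d)} (he : ‖e‖ = 1)
    {N : Set (EuclideanSpace ℝ (Fin d))} (hNm : MeasurableSet N) (hN : volume N = 0) :
    ∀ᵐ g ∂μ, ∀ᵐ k ∂μ, φ g e - φ k e ∉ N := by
  have := h.prob
  have hφ := h.measurable
  have : Nontrivial (EuclideanSpace ℝ (Fin d)) := ⟨e, 0, fun h0 => by simp [h0] at he⟩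
  have hmp : ∀ g : G, MeasurePreserving (φ g)
      (volume : Measure (EuclideanSpace ℝ (Fin d))) volume :=
    fun g => (φ g).measurePreserving
  have hrot : ∀ᵐ w : EuclideanSpace ℝ (Fin d), ∀ᵐ g ∂μ, φ g w ∉ N := by
    rw [← Measure.ae_ae_comm (p := fun g w => φ g w ∉ N) (hφ hNm).compl]
    exact .of_forall fun g => (hmp g).quasiMeasurePreserving.ae (measure_eq_zero_iff_ae_notMem.1 hN)
  let B : Set ℝ := {t | ∃ w : EuclideanSpace ℝ (Fin d), ‖w‖ = t ∧ ¬ ∀ᵐ g ∂μ, φ g w ∉ N}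
  have hB : ∀ᵐ t ∂volume.restrict (Ioi (0 : ℝ)), t ∉ B := by
    refine ae_notMem_of_ae_norm_notMem (V := EuclideanSpace ℝ (Fin d)) volume ?_
    filter_upwards [hrot] with w hw
    rintro ⟨w', hw', hbad⟩
    exact hbad (h.ae_of_norm_eq (p := fun x => x ∉ N) hw'.symm hw)
  let s : Set (EuclideanSpace ℝ (Fin d)) := {v | ∀ᵐ g ∂μ, φ g (e - ‖v‖⁻¹ • v) ∉ N}
  have hs : MeasurableSet s := by
    have hm : MeasurableSet {q : EuclideanSpace ℝ (Fin d) × G |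
        φ q.2 (e - ‖q.1‖⁻¹ • q.1) ∈ N} := by
      have : Measurable fun q : EuclideanSpace ℝ (Fin d) × G =>
          (q.2, e - ‖q.1‖⁻¹ • q.1) := by fun_prop
      exact (hφ.comp this) hNm
    have : s = (fun v => μ (Prod.mk v ⁻¹' {q : EuclideanSpace ℝ (Fin d) × G |
        φ q.2 (e - ‖q.1‖⁻¹ • q.1) ∈ N})) ⁻¹' {0} := by
      ext v
      simp only [s, mem_ofPred_eq, mem_preimage, mem_singleton_iff]
      rw [ae_iff]
      simp
    rw [this]
    exact measurable_measure_prodMk_left hm (measurableSet_singleton _)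
  have hline : ∀ᵐ v : EuclideanSpace ℝ (Fin d), v ∈ s ∪ (ℝ ∙ e : Submodule ℝ _) := by
    refine ae_mem_of_ae_add_linearMap_mem (LinearMap.toSpanSingleton ℝ _ e) volume volume
      (hs.union (Submodule.closed_of_finiteDimensional _).measurableSet) fun y => ?_
    by_cases hy : y ∈ (ℝ ∙ e)
    · refine .of_forall fun a => Or.inr ?_
      exact Submodule.add_mem _ hy (Submodule.smul_mem _ _ (Submodule.mem_span_singleton_self e))
    · set a₀ : ℝ := inner ℝ e y
      have hb : y - a₀ • e ≠ 0 := fun h0 => hy (by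
        rw [sub_eq_zero.1 h0]
        exact Submodule.smul_mem _ _ (Submodule.mem_span_singleton_self e))
      have hbe : inner ℝ e (y - a₀ • e) = 0 := by
        rw [inner_sub_right, inner_smul_right, real_inner_self_eq_norm_sq, he]
        simp [a₀]
      have := (measurePreserving_add_left (volume : Measure ℝ) a₀).quasiMeasurePreserving.ae
        (ae_norm_sub_normalize_notMem hB he hb hbe)
      filter_upwards [this] with a ha
      left
      by_contra hbad
      have hya : y - a₀ • e + (a₀ + a) • e = y + LinearMap.toSpanSingleton ℝ _ e a := by
        rw [LinearMap.toSpanSingleton_apply, add_smul]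
        abel
      rw [hya] at ha
      exact ha ⟨_, rfl, hbad⟩
  have hspan : ∀ᵐ v : EuclideanSpace ℝ (Fin d), v ∉ (ℝ ∙ e) := by
    refine measure_eq_zero_iff_ae_notMem.1 (Measure.addHaar_submodule volume _ fun htop => ?_)
    have h1 := finrank_span_le_card (R := ℝ) ({e} : Set (EuclideanSpace ℝ (Fin d)))
    rw [htop, finrank_top, finrank_euclideanSpace_fin] at h1
    simp at h1
    omega
  have hall : ∀ᵐ v : EuclideanSpace ℝ (Fin d), v ∈ s := by
    filter_upwards [hline, hspan] with v h1 h2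
    exact h1.resolve_right h2
  have hswap : ∀ᵐ v : EuclideanSpace ℝ (Fin d), ∀ᵐ k ∂μ, φ k v ∈ s := by
    rw [← Measure.ae_ae_comm (p := fun k v => φ k v ∈ s) (hφ hs)]
    exact .of_forall fun k => (hmp k).quasiMeasurePreserving.ae hall
  obtain ⟨v, hv, hv0⟩ := (hswap.and hspan).exists
  have hv0 : ‖v‖ ≠ 0 := fun h0 => hv0 (by rw [norm_eq_zero.1 h0]; exact Submodule.zero_mem _)
  have hve : ∀ᵐ k ∂μ, ∀ᵐ g ∂μ, φ g (e - φ k e) ∉ N := by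
    refine h.ae_of_norm_eq (p := fun x => ∀ᵐ g ∂μ, φ g (e - x) ∉ N) (v := ‖v‖⁻¹ • v) ?_ ?_
    · rw [norm_smul, norm_inv, norm_norm, he, inv_mul_cancel₀ hv0]
    · filter_upwards [hv] with k hk
      simpa [s] using hk
  have hm : MeasurableSet {q : G × G | φ q.2 (e - φ q.1 e) ∉ N} := by
    have : Measurable fun q : G × G => (q.2, e - φ q.1 e) :=
      measurable_snd.prodMk
        (measurable_const.sub (hφ.comp (measurable_fst.prodMk measurable_const)))
    exact ((hφ.comp this) hNm).compl
  rw [Measure.ae_ae_comm (p := fun k g => φ g (e - φ k e) ∉ N) hm] at hve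
  filter_upwards [hve] with g hg
  filter_upwards [(h.mul_left g⁻¹).quasiMeasurePreserving.ae hg] with k hk
  simpa using hk

/-- An absolutely continuous probability measure is almost invariant under small translations, in
total variation. -/
lemma exists_pos_forall_integral_sub_integral_translate_le {V : Type*} [NormedAddCommGroup V]
    [NormedSpace ℝ V] [FiniteDimensional ℝ V] [MeasurableSpace V] [BorelSpace V]
    (ν : Measure V) [ν.IsAddHaarMeasure] (κ : Measure V) [IsProbabilityMeasure κ] (hκ : κ ≪ ν)
    {η : ℝ} (hη : 0 < η) :
    ∃ ε > (0 : ℝ), ∀ v : V, ‖v‖ ≤ ε → ∀ F : V → ℝ, Measurable F → (∀ x, 0 ≤ F x) →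
      (∀ x, F x ≤ 1) → |∫ x, F x ∂κ - ∫ x, F (x + v) ∂κ| ≤ η := by
  let f : V → ℝ := fun x => (κ.rnDeriv ν x).toReal
  have hf : Integrable f ν := Measure.integrable_toReal_rnDeriv
  let fL : Lp ℝ 1 ν := hf.toL1 f
  have : Fact ((1 : ℝ≥0∞) ≠ ∞) := ⟨ENNReal.one_ne_top⟩
  have hmk : Continuous fun v : V => DomAddAct.mk (-v) :=
    DomAddAct.continuous_mk.comp continuous_neg
  have hcont : Continuous fun v : V => DomAddAct.mk (-v) +ᵥ fL := hmk.vadd continuous_const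
  obtain ⟨ε, hε, hball⟩ := Metric.continuousAt_iff.1 hcont.continuousAt η hη
  refine ⟨ε / 2, half_pos hε, fun v hv F hF hF0 hF1 => ?_⟩
  have hdist := @hball v (by rw [dist_zero_right]; linarith)
  have hzero : DomAddAct.mk (-(0 : V)) +ᵥ fL = fL := by
    rw [neg_zero, DomAddAct.mk_zero, zero_vadd]
  rw [hzero, L1.dist_eq_integral_dist] at hdist
  have hfv : Integrable (fun x => f (x - v)) ν := hf.comp_sub_right v
  have hae : (fun x => dist ((DomAddAct.mk (-v) +ᵥ fL : Lp ℝ 1 ν) x) (fL x)) =ᵐ[ν]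
      fun x => |f x - f (x - v)| := by
    have h1 := DomAddAct.vadd_Lp_ae_eq (DomAddAct.mk (-v)) fL
    have h2 : fL =ᵐ[ν] f := hf.coeFn_toL1
    have h3 := (measurePreserving_add_left ν (-v)).quasiMeasurePreserving.ae h2
    filter_upwards [h1, h2, h3] with x hx1 hx2 hx3
    rw [hx1, hx2, dist_comm, Real.dist_eq]
    simp only [Equiv.symm_apply_apply, vadd_eq_add]
    rw [hx3, neg_add_eq_sub]
  rw [integral_congr_ae hae] at hdist
  have hFb : ∀ x, ‖F x‖ ≤ 1 := fun x => by
    rw [Real.norm_eq_abs, abs_of_nonneg (hF0 x)]; exact hF1 x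
  have e1 : ∫ x, F x ∂κ = ∫ x, f x * F x ∂ν := (integral_rnDeriv_smul hκ).symm
  have e2 : ∫ x, F (x + v) ∂κ = ∫ x, f (x - v) * F x ∂ν := by
    rw [← integral_rnDeriv_smul hκ, ← integral_add_right_eq_self (fun x => f (x - v) * F x) v]
    simp only [add_sub_cancel_right, smul_eq_mul, f]
  have i1 : Integrable (fun x => f x * F x) ν :=
    hf.mul_bdd (c := 1) hF.aestronglyMeasurable (.of_forall hFb)
  have i2 : Integrable (fun x => f (x - v) * F x) ν :=
    hfv.mul_bdd (c := 1) hF.aestronglyMeasurable (.of_forall hFb)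
  rw [e1, e2, ← integral_sub i1 i2]
  refine (abs_integral_le_integral_abs).trans (le_trans ?_ hdist.le)
  refine integral_mono (i1.sub i2).abs (hf.sub hfv).abs fun x => ?_
  simp only
  rw [← sub_mul, abs_mul]
  exact mul_le_of_le_one_right (abs_nonneg _) (hFb x)

/-- The distribution of the image of a vector under a random group element. -/
noncomputable def orbitMeasure {d : ℕ} {G : Type*} [Group G] [MeasurableSpace G] (μ : Measure G)
    (φ : G →* (EuclideanSpace ℝ (Fin d) ≃ₗᵢ[ℝ] EuclideanSpace ℝ (Fin d)))
    (w : EuclideanSpace ℝ (Fin d)) : Measure (EuclideanSpace ℝ (Fin d)) :=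
  μ.map fun g => φ g w

section OrbitMeasure

variable {d : ℕ} {G : Type*} [Group G] [MeasurableSpace G] {μ : Measure G}
  {φ : G →* (EuclideanSpace ℝ (Fin d) ≃ₗᵢ[ℝ] EuclideanSpace ℝ (Fin d))}

lemma IsRotationFamily.measurable_apply (h : IsRotationFamily μ φ)
    (w : EuclideanSpace ℝ (Fin d)) : Measurable fun g => φ g w :=
  h.measurable.comp (measurable_id.prodMk measurable_const)

lemma IsRotationFamily.isProbabilityMeasure_orbitMeasure (h : IsRotationFamily μ φ)
    (w : EuclideanSpace ℝ (Fin d)) : IsProbabilityMeasure (orbitMeasure μ φ w) :=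
  have := h.prob
  Measure.isProbabilityMeasure_map (h.measurable_apply w).aemeasurable

lemma IsRotationFamily.orbitMeasure_eq_map_smul (h : IsRotationFamily μ φ)
    {e : EuclideanSpace ℝ (Fin d)} (he : ‖e‖ = 1) (w : EuclideanSpace ℝ (Fin d)) :
    orbitMeasure μ φ w = (orbitMeasure μ φ e).map fun x => ‖w‖ • x := by
  obtain ⟨k, hk⟩ := h.transitive (‖w‖ • e) w (by rw [norm_smul, he, norm_norm, mul_one])
  have hm : Measurable fun g => φ g (‖w‖ • e) := h.measurable_apply _
  calc μ.map (fun g => φ g w)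
      = μ.map ((fun g => φ g (‖w‖ • e)) ∘ fun g => g * k) := by
        congr 1
        ext1 g
        simp only [Function.comp_apply, map_mul, LinearIsometryEquiv.coe_mul]
        rw [hk]
    _ = (μ.map fun g => g * k).map (fun g => φ g (‖w‖ • e)) :=
        (Measure.map_map hm (h.mul_right k).measurable).symm
    _ = μ.map fun g => φ g (‖w‖ • e) := by rw [(h.mul_right k).map_eq]
    _ = (orbitMeasure μ φ e).map fun x => ‖w‖ • x := by
        rw [orbitMeasure, Measure.map_map (measurable_const_smul _) (h.measurable_apply e)]
        congr 1
        ext1 g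
        simp

lemma IsRotationFamily.map_sub_orbitMeasure_absolutelyContinuous (hd : 2 ≤ d)
    (h : IsRotationFamily μ φ) {e : EuclideanSpace ℝ (Fin d)} (he : ‖e‖ = 1) :
    (((orbitMeasure μ φ e).prod (orbitMeasure μ φ e)).map fun q => q.1 - q.2) ≪ volume := by
  have := h.prob
  refine Measure.AbsolutelyContinuous.mk fun N hNm hN => ?_
  have hme := h.measurable_apply e
  rw [orbitMeasure, Measure.map_prod_map _ _ hme hme,
    Measure.map_map (by fun_prop) (hme.prodMap hme),
    Measure.map_apply (Measurable.comp (by fun_prop) (hme.prodMap hme)) hNm,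
    Measure.measure_prod_null
      ((Measurable.comp (by fun_prop) (hme.prodMap hme)) hNm)]
  filter_upwards [h.ae_sub_notMem hd he hNm hN] with g hg
  exact measure_eq_zero_iff_ae_notMem.2 hg

/-- The difference of two independent random points of a sphere is almost invariant under
translations that are small compared with the radius. -/
lemma IsRotationFamily.exists_pos_forall_orbitMeasure_translate_le (hd : 2 ≤ d)
    (h : IsRotationFamily μ φ) {η : ℝ} (hη : 0 < η) :
    ∃ ε > (0 : ℝ), ∀ w v : EuclideanSpace ℝ (Fin d), w ≠ 0 → ‖v‖ ≤ ε * ‖w‖ →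
      ∀ F : EuclideanSpace ℝ (Fin d) → ℝ, Measurable F → (∀ x, 0 ≤ F x) → (∀ x, F x ≤ 1) →
        |∫ q, F (q.1 - q.2) ∂(orbitMeasure μ φ w).prod (orbitMeasure μ φ w) -
          ∫ q, F (q.1 - q.2 + v) ∂(orbitMeasure μ φ w).prod (orbitMeasure μ φ w)| ≤ η := by
  let e : EuclideanSpace ℝ (Fin d) := EuclideanSpace.single ⟨0, by omega⟩ 1
  have he : ‖e‖ = 1 := by simp [e]
  have := h.isProbabilityMeasure_orbitMeasure e
  have hsub : Measurable fun q : EuclideanSpace ℝ (Fin d) × EuclideanSpace ℝ (Fin d) =>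
      q.1 - q.2 := by fun_prop
  set κ : Measure (EuclideanSpace ℝ (Fin d)) :=
    ((orbitMeasure μ φ e).prod (orbitMeasure μ φ e)).map fun q => q.1 - q.2 with hκ
  have : IsProbabilityMeasure κ := Measure.isProbabilityMeasure_map hsub.aemeasurable
  obtain ⟨ε, hε, hmain⟩ := exists_pos_forall_integral_sub_integral_translate_le volume κ
    (h.map_sub_orbitMeasure_absolutelyContinuous hd he) hη
  refine ⟨ε, hε, fun w v hw hv F hF hF0 hF1 => ?_⟩
  have hw0 : 0 < ‖w‖ := norm_pos_iff.2 hw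
  have hms : Measurable fun x : EuclideanSpace ℝ (Fin d) => ‖w‖ • x := measurable_const_smul _
  have key : ∀ F : EuclideanSpace ℝ (Fin d) → ℝ, Measurable F →
      ∫ q, F (q.1 - q.2) ∂(orbitMeasure μ φ w).prod (orbitMeasure μ φ w) =
        ∫ x, F (‖w‖ • x) ∂κ := by
    intro F hF
    have hFs : Measurable fun q : EuclideanSpace ℝ (Fin d) × EuclideanSpace ℝ (Fin d) =>
        F (q.1 - q.2) := hF.comp hsub
    have hFm : Measurable fun x => F (‖w‖ • x) := hF.comp hms
    rw [h.orbitMeasure_eq_map_smul he, Measure.map_prod_map _ _ hms hms,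
      integral_map (hms.prodMap hms).aemeasurable hFs.aestronglyMeasurable, hκ,
      integral_map hsub.aemeasurable hFm.aestronglyMeasurable]
    simp [smul_sub]
  rw [key F hF, key (fun x => F (x + v)) (hF.comp (measurable_add_const v))]
  have := hmain (‖w‖⁻¹ • v) (by
    rw [norm_smul, norm_inv, norm_norm, inv_mul_le_iff₀ hw0]; linarith)
    (fun x => F (‖w‖ • x)) (hF.comp hms) (fun x => hF0 _) (fun x => hF1 _)
  simpa [smul_add, smul_smul, hw0.ne'] using this

end OrbitMeasure

section TranslateAverage

variable {V : Type*} [NormedAddCommGroup V] [MeasurableSpace V]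

/-- The average of `F` over translates of a point distributed according to `σ`. -/
noncomputable def translateAverage (σ : Measure V) (F : V → ℝ) (z : V) : ℝ := ∫ x, F (z + x) ∂σ

lemma integrable_of_measurable_of_abs_le {Y : Type*} [MeasurableSpace Y] {ρ : Measure Y}
    [IsFiniteMeasure ρ] {f : Y → ℝ} (hf : Measurable f) {C : ℝ} (hC : ∀ y, |f y| ≤ C) :
    Integrable f ρ :=
  .of_bound hf.aestronglyMeasurable C (.of_forall hC)

lemma abs_translateAverage_le (σ : Measure V) [IsProbabilityMeasure σ] {F : V → ℝ} {C : ℝ}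
    (hC : ∀ x, |F x| ≤ C) (z : V) : |translateAverage σ F z| ≤ C := by
  have := norm_integral_le_of_norm_le_const (μ := σ) (f := fun x => F (z + x))
    (.of_forall fun x => hC _)
  simpa [translateAverage] using this

lemma translateAverage_nonneg (σ : Measure V) {F : V → ℝ} (hF : ∀ x, 0 ≤ F x) (z : V) :
    0 ≤ translateAverage σ F z :=
  integral_nonneg fun _ => hF _

variable [BorelSpace V]

lemma translateAverage_sub (σ : Measure V) [IsProbabilityMeasure σ] {F F' : V → ℝ}
    (hF : Measurable F) (hF' : Measurable F') {C C' : ℝ} (hC : ∀ x, |F x| ≤ C)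
    (hC' : ∀ x, |F' x| ≤ C') (z : V) :
    translateAverage σ (fun x => F x - F' x) z =
      translateAverage σ F z - translateAverage σ F' z :=
  integral_sub
    (integrable_of_measurable_of_abs_le (hF.comp (measurable_const_add z)) fun _ => hC _)
    (integrable_of_measurable_of_abs_le (hF'.comp (measurable_const_add z)) fun _ => hC' _)

variable [SecondCountableTopology V]

lemma measurable_translateAverage (σ : Measure V) [IsProbabilityMeasure σ] {F : V → ℝ}
    (hF : Measurable F) : Measurable (translateAverage σ F) :=
  (StronglyMeasurable.integral_prod_right (f := fun z x => F (z + x))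
    (hF.comp measurable_add).stronglyMeasurable).measurable

variable {ν : Measure V} [ν.IsAddLeftInvariant] [SFinite ν]

lemma integrable_comp_add_prod {Y : Type*} [MeasurableSpace Y] {ρ : Measure Y}
    [IsProbabilityMeasure ρ] {τ : Y → V} (hτ : Measurable τ) {F : V → ℝ} (hF : Measurable F)
    (hFi : Integrable F ν) : Integrable (fun p : V × Y => F (p.1 + τ p.2)) (ν.prod ρ) := by
  have hm : Measurable fun p : V × Y => F (p.1 + τ p.2) := by fun_prop
  rw [integrable_prod_iff' hm.aestronglyMeasurable]
  refine ⟨.of_forall fun y => hFi.comp_add_right (τ y), ?_⟩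
  simp_rw [fun y => integral_add_right_eq_self (μ := ν) (fun x => ‖F x‖) (τ y)]
  exact integrable_const _

lemma integrable_translateAverage (σ : Measure V) [IsProbabilityMeasure σ] {F : V → ℝ}
    (hF : Measurable F) (hFi : Integrable F ν) : Integrable (translateAverage σ F) ν :=
  (integrable_comp_add_prod measurable_id hF hFi).integral_prod_left

lemma integral_translateAverage (σ : Measure V) [IsProbabilityMeasure σ] {F : V → ℝ}
    (hF : Measurable F) (hFi : Integrable F ν) :
    ∫ z, translateAverage σ F z ∂ν = ∫ z, F z ∂ν := by
  simp only [translateAverage]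
  rw [integral_integral_swap (integrable_comp_add_prod measurable_id hF hFi)]
  simp_rw [fun y => integral_add_right_eq_self (μ := ν) F y]
  simp

lemma integral_translateAverage_sq_le (σ : Measure V) [IsProbabilityMeasure σ] {g : V → ℝ}
    (hg : Measurable g) (hgi : Integrable g ν) (hg1 : ∀ x, |g x| ≤ 1) {η : ℝ}
    (hη : ∀ z, |∫ q, g (z + (q.1 - q.2)) ∂σ.prod σ| ≤ η) :
    ∫ z, translateAverage σ g z ^ 2 ∂ν ≤ η * ∫ z, |g z| ∂ν := by
  have hsq : ∀ z, translateAverage σ g z ^ 2 = ∫ q, g (z + q.1) * g (z + q.2) ∂σ.prod σ := by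
    intro z
    rw [sq, translateAverage, ← integral_prod_mul]
  have hi1 : Integrable (fun p : V × V × V => g (p.1 + p.2.1) * g (p.1 + p.2.2))
      (ν.prod (σ.prod σ)) :=
    (integrable_comp_add_prod measurable_fst hg hgi).mul_bdd (c := 1)
      (Measurable.aestronglyMeasurable (by fun_prop)) (.of_forall fun p => hg1 _)
  have hi2 : Integrable (fun p : V × V × V => g p.1 * g (p.1 + (p.2.1 - p.2.2)))
      (ν.prod (σ.prod σ)) := by
    have := (integrable_comp_add_prod (ρ := σ.prod σ) (τ := fun _ => 0) measurable_const hg hgi)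
    simp only [add_zero] at this
    exact this.mul_bdd (c := 1)
      (Measurable.aestronglyMeasurable (by fun_prop)) (.of_forall fun p => hg1 _)
  have hshift : ∀ q : V × V, ∫ z, g (z + q.1) * g (z + q.2) ∂ν =
      ∫ z, g z * g (z + (q.1 - q.2)) ∂ν := by
    intro q
    rw [← integral_add_right_eq_self (μ := ν) (fun z => g z * g (z + (q.1 - q.2))) q.2]
    refine integral_congr_ae (.of_forall fun z => ?_)
    simp only
    rw [mul_comm, add_assoc z q.2, add_sub_cancel]
  calc ∫ z, translateAverage σ g z ^ 2 ∂ν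
      = ∫ z, ∫ q, g (z + q.1) * g (z + q.2) ∂σ.prod σ ∂ν := by simp_rw [hsq]
    _ = ∫ q, ∫ z, g z * g (z + (q.1 - q.2)) ∂ν ∂σ.prod σ := by
        rw [integral_integral_swap hi1]
        simp_rw [hshift]
    _ = ∫ z, g z * ∫ q, g (z + (q.1 - q.2)) ∂σ.prod σ ∂ν := by
        rw [← integral_integral_swap hi2]
        simp_rw [integral_const_mul]
    _ ≤ ∫ z, η * |g z| ∂ν := by
        refine integral_mono ?_ (hgi.abs.const_mul η) fun z => ?_
        · have := hi2.integral_prod_left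
          simpa only [integral_const_mul] using this
        · refine (le_abs_self _).trans ?_
          rw [abs_mul, mul_comm]
          exact mul_le_mul_of_nonneg_right (hη z) (abs_nonneg _)
    _ = η * ∫ z, |g z| ∂ν := integral_const_mul _ _

/-- If the difference of two independent `σ`-random points is almost invariant under
`β`-random translations, then smoothing by `β` hardly affects the correlation of a function with
its `σ`-average. -/
lemma integral_mul_translateAverage_smooth_le (σ β : Measure V) [IsProbabilityMeasure σ]
    [IsProbabilityMeasure β] {F : V → ℝ} (hF : Measurable F) (hF0 : ∀ x, 0 ≤ F x)
    (hF1 : ∀ x, F x ≤ 1) (hFi : Integrable F ν) {s : ℝ} (hs : 0 < s)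
    (hβ : ∀ᵐ u ∂β, ∀ G : V → ℝ, Measurable G → (∀ x, 0 ≤ G x) → (∀ x, G x ≤ 1) →
      |∫ q, G (q.1 - q.2) ∂σ.prod σ - ∫ q, G (q.1 - q.2 + u) ∂σ.prod σ| ≤ s ^ 2) :
    ∫ z, F z * translateAverage σ (translateAverage β F) z ∂ν - 3 / 2 * s * ∫ z, F z ∂ν ≤
      ∫ z, F z * translateAverage σ F z ∂ν := by
  have habs : ∀ x, |F x| ≤ 1 := fun x => by rw [abs_of_nonneg (hF0 x)]; exact hF1 x
  set M : V → ℝ := translateAverage β F with hM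
  have hMm : Measurable M := measurable_translateAverage β hF
  have hM0 : ∀ x, 0 ≤ M x := translateAverage_nonneg β hF0
  have hMabs : ∀ x, |M x| ≤ 1 := abs_translateAverage_le β habs
  have hMi : Integrable M ν := integrable_translateAverage β hF hFi
  let g : V → ℝ := fun x => F x - M x
  have hg : Measurable g := hF.sub hMm
  have hgi : Integrable g ν := hFi.sub hMi
  have hg1 : ∀ x, |g x| ≤ 1 := fun x => by
    have := (abs_le.1 (hMabs x)).2
    exact abs_le.2 ⟨by linarith [hF0 x], by linarith [hF1 x, hM0 x]⟩
  have hcorr : ∀ z, |∫ q, g (z + (q.1 - q.2)) ∂σ.prod σ| ≤ s ^ 2 := by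
    intro z
    have hmeas : Measurable fun p : (V × V) × V =>
        F (z + (p.1.1 - p.1.2)) - F (z + (p.1.1 - p.1.2 + p.2)) := by fun_prop
    have h_int : Integrable (fun p : (V × V) × V =>
        F (z + (p.1.1 - p.1.2)) - F (z + (p.1.1 - p.1.2 + p.2))) ((σ.prod σ).prod β) :=
      integrable_of_measurable_of_abs_le hmeas (C := 2) fun p => by
        have h1 := habs (z + (p.1.1 - p.1.2))
        have h2 := habs (z + (p.1.1 - p.1.2 + p.2))
        exact (abs_sub _ _).trans (by linarith)
    have hrew : ∀ q : V × V, g (z + (q.1 - q.2)) =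
        ∫ u, F (z + (q.1 - q.2)) - F (z + (q.1 - q.2 + u)) ∂β := by
      intro q
      rw [integral_sub (integrable_const _) (integrable_of_measurable_of_abs_le (by fun_prop)
        fun _ => habs _)]
      simp [g, hM, translateAverage, add_assoc]
    simp_rw [hrew]
    rw [integral_integral_swap h_int]
    have := norm_integral_le_of_norm_le_const (μ := β) (C := s ^ 2)
      (f := fun u => ∫ q : V × V, F (z + (q.1 - q.2)) - F (z + (q.1 - q.2 + u)) ∂σ.prod σ) ?_
    · simpa using this
    · filter_upwards [hβ] with u hu
      rw [integral_sub
        (integrable_of_measurable_of_abs_le (by fun_prop) fun _ => habs _)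
        (integrable_of_measurable_of_abs_le (by fun_prop) fun _ => habs _)]
      exact hu (fun x => F (z + x)) (by fun_prop) (fun x => hF0 _) fun x => hF1 _
  have hsq := integral_translateAverage_sq_le σ hg hgi hg1 hcorr
  have hgabs : ∫ z, |g z| ∂ν ≤ 2 * ∫ z, F z ∂ν := by
    calc ∫ z, |g z| ∂ν ≤ ∫ z, F z + M z ∂ν :=
          integral_mono hgi.abs (hFi.add hMi) fun z =>
            abs_le.2 ⟨by simp only [g]; linarith [hF0 z], by simp only [g]; linarith [hM0 z]⟩
      _ = 2 * ∫ z, F z ∂ν := by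
          rw [integral_add hFi hMi, hM, integral_translateAverage β hF hFi]; ring
  set H : V → ℝ := translateAverage σ g
  have hHm : Measurable H := measurable_translateAverage σ hg
  have hHi : Integrable H ν := integrable_translateAverage σ hg hgi
  have hH1 : ∀ x, |H x| ≤ 1 := abs_translateAverage_le σ hg1
  have hHeq : ∀ z, H z = translateAverage σ F z - translateAverage σ M z :=
    translateAverage_sub σ hF hMm habs hMabs
  have hHsq : Integrable (fun z => H z ^ 2) ν := by
    simp_rw [sq]
    exact hHi.mul_bdd (c := 1) hHm.aestronglyMeasurable (.of_forall hH1)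
  have hi : ∀ f : V → ℝ, Measurable f → (∀ x, |f x| ≤ 1) → Integrable (fun z => F z * f z) ν :=
    fun f hf hf1 => hFi.mul_bdd (c := 1) hf.aestronglyMeasurable (.of_forall hf1)
  have hpoint : ∀ z, -(F z * H z) ≤ s / 2 * F z + 1 / (2 * s) * H z ^ 2 := by
    intro z
    have h1 : 0 ≤ (s * F z + H z) ^ 2 / (2 * s) := by positivity
    have h2 : (s * F z + H z) ^ 2 / (2 * s) =
        s / 2 * F z ^ 2 + F z * H z + 1 / (2 * s) * H z ^ 2 := by
      field_simp
      ring
    have h3 : F z ^ 2 ≤ F z := by nlinarith [hF0 z, hF1 z]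
    nlinarith
  have hle : -∫ z, F z * H z ∂ν ≤ s / 2 * ∫ z, F z ∂ν + 1 / (2 * s) * ∫ z, H z ^ 2 ∂ν := by
    rw [← integral_neg, ← integral_const_mul, ← integral_const_mul,
      ← integral_add (hFi.const_mul _) (hHsq.const_mul _)]
    exact integral_mono (hi H hHm hH1).neg ((hFi.const_mul _).add (hHsq.const_mul _)) hpoint
  have hsplit : ∫ z, F z * H z ∂ν = ∫ z, F z * translateAverage σ F z ∂ν -
      ∫ z, F z * translateAverage σ M z ∂ν := by
    rw [← integral_sub (hi _ (measurable_translateAverage σ hF) (abs_translateAverage_le σ habs))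
      (hi _ (measurable_translateAverage σ hMm) (abs_translateAverage_le σ hMabs))]
    simp_rw [hHeq, mul_sub]
  have hfin : 1 / (2 * s) * ∫ z, H z ^ 2 ∂ν ≤ s * ∫ z, F z ∂ν := by
    have : ∫ z, H z ^ 2 ∂ν ≤ s ^ 2 * (2 * ∫ z, F z ∂ν) :=
      hsq.trans (mul_le_mul_of_nonneg_left hgabs (sq_nonneg s))
    calc 1 / (2 * s) * ∫ z, H z ^ 2 ∂ν ≤ 1 / (2 * s) * (s ^ 2 * (2 * ∫ z, F z ∂ν)) :=
          mul_le_mul_of_nonneg_left this (by positivity)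
      _ = s * ∫ z, F z ∂ν := by field_simp
  linarith

/-- A lower bound for the correlation of `F` with a double average of itself, when the first
average is at most `m` and everything is supported on `W`. -/
lemma le_integral_mul_translateAverage_translateAverage (σ β : Measure V) [IsProbabilityMeasure σ]
    [IsProbabilityMeasure β] {F : V → ℝ} (hF : Measurable F) (hF0 : ∀ x, 0 ≤ F x)
    (hF1 : ∀ x, F x ≤ 1) (hFi : Integrable F ν) {m : ℝ}
    (hm : ∀ z, translateAverage β F z ≤ m) {W : Set V} (hW : MeasurableSet W) (hWfin : ν W ≠ ∞)
    (hFW : ∀ z, z ∉ W → F z = 0)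
    (hAW : ∀ z, z ∉ W → translateAverage σ (translateAverage β F) z = 0) :
    m * ∫ z, F z ∂ν - (m * ν.real W - ∫ z, F z ∂ν) ≤
      ∫ z, F z * translateAverage σ (translateAverage β F) z ∂ν := by
  have habs : ∀ x, |F x| ≤ 1 := fun x => by rw [abs_of_nonneg (hF0 x)]; exact hF1 x
  have hMm := measurable_translateAverage β hF
  have hMabs := abs_translateAverage_le β habs
  have hMi : Integrable (translateAverage β F) ν := integrable_translateAverage β hF hFi
  set A : V → ℝ := translateAverage σ (translateAverage β F) with hA
  have hAi : Integrable A ν := integrable_translateAverage σ hMm hMi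
  have hAint : ∫ z, A z ∂ν = ∫ z, F z ∂ν := by
    rw [hA, integral_translateAverage σ hMm hMi, integral_translateAverage β hF hFi]
  have hAm : ∀ z, A z ≤ m := fun z => by
    have : A z ≤ ∫ _, m ∂σ := integral_mono
      (integrable_of_measurable_of_abs_le (hMm.comp (measurable_const_add z)) fun _ => hMabs _)
      (integrable_const _) fun x => hm _
    simpa using this
  have hFA : Integrable (fun z => F z * A z) ν :=
    hFi.mul_bdd (c := 1) (measurable_translateAverage σ hMm).aestronglyMeasurable
      (.of_forall (abs_translateAverage_le σ hMabs))
  have hWi : Integrable (W.indicator fun _ => m) ν :=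
    (integrable_indicator_iff hW).2 (integrableOn_const hWfin)
  have hle : ∫ z, m * F z - F z * A z ∂ν ≤ ∫ z, W.indicator (fun _ => m) z - A z ∂ν := by
    refine integral_mono ((hFi.const_mul m).sub hFA) (hWi.sub hAi) fun z => ?_
    by_cases hz : z ∈ W
    · simp only [indicator_of_mem hz]
      nlinarith [hF1 z, hAm z, hF0 z]
    · simp [indicator_of_notMem hz, hFW z hz, hAW z hz]
  rw [integral_sub (hFi.const_mul m) hFA, integral_sub hWi hAi, integral_const_mul, hAint,
    integral_indicator_const m hW, smul_eq_mul] at hle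
  linarith

end TranslateAverage

section Density

variable {d : ℕ} {E : Set (EuclideanSpace ℝ (Fin d))}

lemma exists_forall_volume_real_inter_closedBall_le {m : ℝ}
    (hm : upperBanachDensity d E < ENNReal.ofReal m) :
    ∃ R > (0 : ℝ), ∀ r, R ≤ r → ∀ x, volume.real (E ∩ Metric.closedBall x r) ≤
      m * volume.real (Metric.closedBall x r) := by
  have hm0 : 0 ≤ m := (ENNReal.ofReal_pos.1 (bot_le.trans_lt hm)).le
  obtain ⟨R, hR⟩ := eventually_atTop.1 (eventually_lt_of_limsup_lt hm)
  refine ⟨max R 1, by positivity, fun r hr x => ?_⟩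
  have hr0 : 0 < r := zero_lt_one.trans_le ((le_max_right _ _).trans hr)
  have h1 : volume (E ∩ Metric.closedBall x r) / volume (Metric.closedBall x r) ≤
      ENNReal.ofReal m :=
    (le_iSup (fun x => volume (E ∩ Metric.closedBall x r) / volume (Metric.closedBall x r)) x).trans
      (hR r ((le_max_left _ _).trans hr)).le
  rw [ENNReal.div_le_iff (Metric.measure_closedBall_pos volume x hr0).ne'
    measure_closedBall_lt_top.ne] at h1
  have h2 := ENNReal.toReal_mono (ENNReal.mul_ne_top ENNReal.ofReal_ne_top
    measure_closedBall_lt_top.ne) h1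
  rwa [ENNReal.toReal_mul, ENNReal.toReal_ofReal hm0] at h2

lemma exists_le_volume_real_inter_closedBall {a : ℝ} (ha0 : 0 ≤ a)
    (ha : ENNReal.ofReal a < upperBanachDensity d E) (L₀ : ℝ) :
    ∃ L, L₀ ≤ L ∧ ∃ x, a * volume.real (Metric.closedBall x L) ≤
      volume.real (E ∩ Metric.closedBall x L) := by
  obtain ⟨L, hL, hlt⟩ := frequently_atTop.1 (frequently_lt_of_lt_limsup (by isBoundedDefault) ha)
    (max L₀ 1)
  obtain ⟨x, hx⟩ := lt_iSup_iff.1 hlt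
  have hL0 : 0 < L := zero_lt_one.trans_le ((le_max_right _ _).trans hL)
  refine ⟨L, (le_max_left _ _).trans hL, x, ?_⟩
  have h1 := (ENNReal.le_div_iff_mul_le (.inl (Metric.measure_closedBall_pos volume x hL0).ne')
    (.inl measure_closedBall_lt_top.ne)).1 hx.le
  have h2 := ENNReal.toReal_mono
    (measure_ne_top_of_subset inter_subset_right measure_closedBall_lt_top.ne) h1
  rwa [ENNReal.toReal_mul, ENNReal.toReal_ofReal ha0] at h2

lemma upperBanachDensity_le_one : upperBanachDensity d E ≤ 1 :=
  limsup_le_of_le (by isBoundedDefault) (.of_forall fun _ => iSup_le fun _ =>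
    ENNReal.div_le_of_le_mul (by rw [one_mul]; exact measure_mono inter_subset_right))

lemma exists_forall_volume_real_closedBall_add_le (d : ℕ) (c : ℝ) {δ : ℝ} (hδ : 0 < δ) :
    ∃ L₀ > (0 : ℝ), ∀ L, L₀ ≤ L → ∀ x : EuclideanSpace ℝ (Fin d),
      volume.real (Metric.closedBall x (L + c)) ≤
        (1 + δ) * volume.real (Metric.closedBall x L) := by
  have h : Tendsto (fun L : ℝ => (1 + c / L) ^ d) atTop (𝓝 1) := by
    simpa using ((tendsto_const_nhds (x := c)).div_atTop tendsto_id).const_add 1 |>.pow d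
  obtain ⟨L₁, hL₁⟩ := eventually_atTop.1 (h.eventually (gt_mem_nhds (lt_add_of_pos_right 1 hδ)))
  refine ⟨max L₁ (|c| + 1), by positivity, fun L hL x => ?_⟩
  have hLc : |c| + 1 ≤ L := (le_max_right _ _).trans hL
  have hL0 : 0 < L := by linarith [abs_nonneg c]
  rw [Measure.addHaar_real_closedBall' _ _ hL0.le,
    Measure.addHaar_real_closedBall' _ _ (by linarith [neg_abs_le c]), finrank_euclideanSpace_fin,
    ← mul_assoc]
  refine mul_le_mul_of_nonneg_right ?_ measureReal_nonneg
  have hfac : L + c = (1 + c / L) * L := by field_simp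
  rw [hfac, mul_pow]
  exact mul_le_mul_of_nonneg_right (hL₁ L ((le_max_left _ _).trans hL)).le (by positivity)

lemma translateAverage_cond_closedBall_le {A : Set (EuclideanSpace ℝ (Fin d))}
    (hA : MeasurableSet A) {t m : ℝ} (ht : 0 < t) (z : EuclideanSpace ℝ (Fin d))
    (h : volume.real (A ∩ Metric.closedBall z t) ≤ m * volume.real (Metric.closedBall z t)) :
    translateAverage (ProbabilityTheory.cond volume (Metric.closedBall 0 t))
      (A.indicator fun _ => (1 : ℝ)) z ≤ m := by
  have hpre : ∀ T : Set (EuclideanSpace ℝ (Fin d)),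
      volume.real ((fun x => z + x) ⁻¹' T) = volume.real T := fun T => by
    rw [measureReal_def, measure_preimage_add, measureReal_def]
  have hball : (fun x => z + x) ⁻¹' Metric.closedBall z t = Metric.closedBall 0 t := by
    ext x
    simp
  have hpos : 0 < volume.real (Metric.closedBall z t) :=
    ENNReal.toReal_pos (Metric.measure_closedBall_pos volume z ht).ne' measure_closedBall_lt_top.ne
  have hcomp : (fun x => A.indicator (fun _ => (1 : ℝ)) (z + x)) =
      ((fun x => z + x) ⁻¹' A).indicator fun _ => 1 := rfl
  rw [translateAverage, hcomp, integral_indicator_const _ (measurable_const_add z hA), smul_eq_mul,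
    mul_one, measureReal_def, ProbabilityTheory.cond_apply Metric.isClosed_closedBall.measurableSet,
    ENNReal.toReal_mul, ENNReal.toReal_inv, ← hball, ← preimage_inter, ← measureReal_def,
    ← measureReal_def, hpre, hpre, inter_comm, inv_mul_le_iff₀ hpos, mul_comm]
  exact h

end Density

section Support

variable {V : Type*} [NormedAddCommGroup V] [MeasurableSpace V]

lemma translateAverage_eq_zero_of_notMem_closedBall {σ : Measure V} {c : ℝ}
    (hσ : ∀ᵐ x ∂σ, ‖x‖ ≤ c) {F : V → ℝ} {p : V} {L : ℝ}
    (hF : ∀ z, z ∉ Metric.closedBall p L → F z = 0) {z : V}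
    (hz : z ∉ Metric.closedBall p (L + c)) : translateAverage σ F z = 0 := by
  refine integral_eq_zero_of_ae ?_
  filter_upwards [hσ] with x hx
  refine hF _ fun hmem => hz ?_
  rw [Metric.mem_closedBall] at hmem ⊢
  have h : dist z p ≤ dist z (z + x) + dist (z + x) p := dist_triangle _ _ _
  rw [dist_self_add_right] at h
  linarith

lemma integral_sub_integral_mul_translateAverage_le [BorelSpace V] [SecondCountableTopology V]
    {ν : Measure V} [ν.IsAddLeftInvariant] [SFinite ν]
    (σ β : Measure V) [IsProbabilityMeasure σ]
    [IsProbabilityMeasure β] {F : V → ℝ} (hF : Measurable F) (hF0 : ∀ x, 0 ≤ F x)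
    (hF1 : ∀ x, F x ≤ 1) (hFi : Integrable F ν) {s : ℝ} (hs : 0 < s)
    (hβ : ∀ᵐ u ∂β, ∀ G : V → ℝ, Measurable G → (∀ x, 0 ≤ G x) → (∀ x, G x ≤ 1) →
      |∫ q, G (q.1 - q.2) ∂σ.prod σ - ∫ q, G (q.1 - q.2 + u) ∂σ.prod σ| ≤ s ^ 2)
    {m : ℝ} (hm : ∀ z, translateAverage β F z ≤ m) {p : V} {L b c : ℝ} (hb0 : 0 ≤ b) (hc0 : 0 ≤ c)
    (hFp : ∀ z, z ∉ Metric.closedBall p L → F z = 0) (hb : ∀ᵐ x ∂β, ‖x‖ ≤ b)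
    (hc : ∀ᵐ x ∂σ, ‖x‖ ≤ c) (hfin : ν (Metric.closedBall p (L + b + c)) ≠ ∞) :
    ∫ z, F z ∂ν - ∫ z, F z * translateAverage σ F z ∂ν ≤
      m * ν.real (Metric.closedBall p (L + b + c)) - m * ∫ z, F z ∂ν +
        3 / 2 * s * ∫ z, F z ∂ν := by
  have h1 := integral_mul_translateAverage_smooth_le (ν := ν) σ β hF hF0 hF1 hFi hs hβ
  have h2 := le_integral_mul_translateAverage_translateAverage (ν := ν) σ β hF hF0 hF1 hFi hm
    Metric.isClosed_closedBall.measurableSet hfin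
    (fun z hz => hFp z fun h => hz (Metric.closedBall_subset_closedBall (by linarith) h))
    (fun z hz => translateAverage_eq_zero_of_notMem_closedBall hc
      (fun y hy => translateAverage_eq_zero_of_notMem_closedBall hb hFp hy) hz)
  linarith

end Support

/-- A union bound: if, on average over rotations, translating `A` by the rotated `w i` loses less
than the measure of `A` in total, then some rotated configuration fits into `A`. -/
lemma IsRotationFamily.exists_forall_add_mem {d : ℕ} {G : Type*} [Group G] [MeasurableSpace G]
    {μ : Measure G} {φ : G →* (EuclideanSpace ℝ (Fin d) ≃ₗᵢ[ℝ] EuclideanSpace ℝ (Fin d))}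
    (h : IsRotationFamily μ φ) {ι : Type*} [Fintype ι] (w : ι → EuclideanSpace ℝ (Fin d))
    {A : Set (EuclideanSpace ℝ (Fin d))} (hA : MeasurableSet A) (hAfin : volume A ≠ ∞)
    (hlt : ∑ i, (volume.real A - ∫ z, A.indicator (fun _ => (1 : ℝ)) z *
      translateAverage (orbitMeasure μ φ (w i)) (A.indicator fun _ => 1) z) < volume.real A) :
    ∃ g z, z ∈ A ∧ ∀ i, z + φ g (w i) ∈ A := by
  have := h.prob
  have := fun i => h.isProbabilityMeasure_orbitMeasure (w i)
  by_contra! hno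
  set F : EuclideanSpace ℝ (Fin d) → ℝ := A.indicator fun _ => 1 with hFdef
  have hF : Measurable F := measurable_const.indicator hA
  have hF0 : ∀ x, 0 ≤ F x := indicator_nonneg fun _ _ => zero_le_one
  have hF1 : ∀ x, F x ≤ 1 := fun x => indicator_le_self' (fun _ _ => zero_le_one) x
  have habs : ∀ x, |F x| ≤ 1 := fun x => by rw [abs_of_nonneg (hF0 x)]; exact hF1 x
  have hFi : Integrable F := (integrable_indicator_iff hA).2 (integrableOn_const hAfin)
  have hFint : ∫ z, F z = volume.real A := by simp [hFdef, integral_indicator_const _ hA]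
  have hpt : ∀ z g, F z ≤ ∑ i, (F z - F z * F (z + φ g (w i))) := by
    intro z g
    have hnn : ∀ i ∈ Finset.univ, 0 ≤ F z - F z * F (z + φ g (w i)) := fun i _ => by
      nlinarith [hF0 z, hF1 (z + φ g (w i))]
    by_cases hz : z ∈ A
    · obtain ⟨i, hi⟩ := hno g z hz
      refine le_trans ?_ (Finset.single_le_sum hnn (Finset.mem_univ i))
      simp [hFdef, indicator_of_notMem hi]
    · rw [hFdef, indicator_of_notMem hz]
      simp
  have hgi : ∀ z i, Integrable (fun g => F (z + φ g (w i))) μ := fun z i =>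
    integrable_of_measurable_of_abs_le
      (hF.comp ((measurable_const_add z).comp (h.measurable_apply (w i)))) fun _ => habs _
  have hgi' : ∀ z i, Integrable (fun g => F z - F z * F (z + φ g (w i))) μ := fun z i =>
    (integrable_const _).sub ((hgi z i).const_mul _)
  have havg : ∀ z, F z ≤ ∑ i, (F z - F z * translateAverage (orbitMeasure μ φ (w i)) F z) := by
    intro z
    have hle : ∫ _, F z ∂μ ≤ ∫ g, ∑ i, (F z - F z * F (z + φ g (w i))) ∂μ :=
      integral_mono (integrable_const _) (integrable_finsetSum _ fun i _ => hgi' z i) (hpt z)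
    rw [integral_finsetSum _ fun i _ => hgi' z i] at hle
    simp_rw [integral_sub (integrable_const _) ((hgi z _).const_mul _), integral_const_mul] at hle
    simp only [integral_const, probReal_univ, one_smul] at hle
    refine hle.trans_eq (Finset.sum_congr rfl fun i _ => ?_)
    rw [translateAverage, orbitMeasure, integral_map (h.measurable_apply (w i)).aemeasurable
      (f := fun x => F (z + x)) (hF.comp (measurable_const_add z)).aestronglyMeasurable]
  have hFA : ∀ i, Integrable fun z => F z * translateAverage (orbitMeasure μ φ (w i)) F z :=
    fun i => hFi.mul_bdd (c := 1) (measurable_translateAverage _ hF).aestronglyMeasurable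
      (.of_forall (abs_translateAverage_le _ habs))
  have hFA' : ∀ i, Integrable fun z =>
      F z - F z * translateAverage (orbitMeasure μ φ (w i)) F z := fun i => hFi.sub (hFA i)
  have htot := integral_mono hFi (integrable_finsetSum _ fun i _ => hFA' i) havg
  rw [integral_finsetSum _ fun i _ => hFA' i] at htot
  simp_rw [integral_sub hFi (hFA _), hFint] at htot
  exact absurd hlt (not_lt.2 htot)

lemma exists_pos_lt_mul_lt_one {k ρ : ℝ} (hρ0 : 0 < ρ) (hρ : k < (k + 1) * ρ) :
    ∃ δ > (0 : ℝ), δ < ρ ∧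
      (k + 1) * ((ρ + δ) * (1 + δ) / (ρ - δ) - (ρ + δ) + 3 / 2 * δ) < 1 := by
  have hc : ContinuousAt (fun δ : ℝ =>
      (k + 1) * ((ρ + δ) * (1 + δ) / (ρ - δ) - (ρ + δ) + 3 / 2 * δ)) 0 := by
    have : ρ - 0 ≠ 0 := by simpa using hρ0.ne'
    fun_prop (disch := assumption)
  have h0 : (k + 1) * ((ρ + 0) * (1 + 0) / (ρ - 0) - (ρ + 0) + 3 / 2 * 0) < 1 := by
    simp only [add_zero, mul_one, sub_zero, mul_zero]
    rw [div_self hρ0.ne']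
    linarith
  have hev := (hc.eventually_lt continuousAt_const h0).filter_mono (nhdsWithin_le_nhds (s := Ioi 0))
  obtain ⟨δ, ⟨h1, h2⟩, h3⟩ := ((hev.and (nhdsWithin_le_nhds (gt_mem_nhds hρ0))).and
    self_mem_nhdsWithin).exists
  exact ⟨δ, h3, h2, h1⟩

/-- The version of the main result for translated rotated configurations, in which the first point
is the centre of rotation. -/
lemma exists_pos_forall_exists_add_mem {d k : ℕ} (hd : 2 ≤ d) {S D : ℝ} (hS : 0 < S)
    {E : Set (EuclideanSpace ℝ (Fin d))} (hE : MeasurableSet E)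
    (hρ : ENNReal.ofReal (k / (k + 1)) < upperBanachDensity d E) :
    ∃ R > (0 : ℝ), ∀ y : Fin (k + 1) → EuclideanSpace ℝ (Fin d),
      (∀ i, S ≤ ‖y i‖ ∧ ‖y i‖ ≤ D) → ∀ r : ℝ, R ≤ r →
        ∃ Q : EuclideanSpace ℝ (Fin d) ≃ₗᵢ[ℝ] EuclideanSpace ℝ (Fin d), IsRotation Q ∧
          ∃ z, z ∈ E ∧ ∀ i, z + Q (r • y i) ∈ E := by
  obtain ⟨G, _, _, μ, φ, h⟩ := exists_isRotationFamily d hd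
  have hρ1 : upperBanachDensity d E ≠ ∞ :=
    (upperBanachDensity_le_one.trans_lt ENNReal.one_lt_top).ne
  obtain ⟨ρ, hρE⟩ : ∃ ρ : ℝ, upperBanachDensity d E = ENNReal.ofReal ρ :=
    ⟨_, (ENNReal.ofReal_toReal hρ1).symm⟩
  rw [hρE] at hρ
  have hρ0 : 0 < ρ := ENNReal.ofReal_pos.1 (bot_le.trans_lt hρ)
  rw [ENNReal.ofReal_lt_ofReal_iff hρ0, div_lt_iff₀ (by positivity), mul_comm] at hρ
  obtain ⟨δ, hδ, hδρ, hnum⟩ := exists_pos_lt_mul_lt_one hρ0 hρ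
  obtain ⟨R₀, hR₀, hupper⟩ := exists_forall_volume_real_inter_closedBall_le (E := E) (m := ρ + δ)
    (by rw [hρE]; exact (ENNReal.ofReal_lt_ofReal_iff (by linarith)).2 (by linarith))
  obtain ⟨ε, hε, hsmooth⟩ :=
    h.exists_pos_forall_orbitMeasure_translate_le hd (η := δ ^ 2) (by positivity)
  refine ⟨R₀ / (ε * S), by positivity, fun y hy r hr => ?_⟩
  have hr0 : 0 < r := lt_of_lt_of_le (by positivity) hr
  set t := ε * (r * S) with ht
  have ht0 : 0 < t := by positivity
  have htR : R₀ ≤ t := by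
    rw [div_le_iff₀ (by positivity)] at hr
    linarith
  have hw : ∀ i, ‖r • y i‖ = r * ‖y i‖ := fun i => by rw [norm_smul, Real.norm_of_nonneg hr0.le]
  have hD : 0 < D := hS.trans_le ((hy 0).1.trans (hy 0).2)
  obtain ⟨L₀, hL₀, hgrow⟩ := exists_forall_volume_real_closedBall_add_le d (t + r * D) hδ
  obtain ⟨L, hL, p, hp⟩ := exists_le_volume_real_inter_closedBall (E := E) (a := ρ - δ)
    (by linarith) (by rw [hρE]; exact (ENNReal.ofReal_lt_ofReal_iff hρ0).2 (by linarith)) L₀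
  have hL0 : 0 < L := hL₀.trans_le hL
  set A := E ∩ Metric.closedBall p L
  have hA : MeasurableSet A := hE.inter Metric.isClosed_closedBall.measurableSet
  have hAfin : volume A ≠ ∞ :=
    measure_ne_top_of_subset inter_subset_right measure_closedBall_lt_top.ne
  have hB : 0 < volume.real (Metric.closedBall p L) :=
    ENNReal.toReal_pos (Metric.measure_closedBall_pos volume p hL0).ne' measure_closedBall_lt_top.ne
  have hA0 : 0 < volume.real A := lt_of_lt_of_le (mul_pos (by linarith) hB) hp
  suffices ∃ g z, z ∈ A ∧ ∀ i, z + φ g (r • y i) ∈ A by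
    obtain ⟨g, z, hz, hgz⟩ := this
    exact ⟨φ g, h.rotation g, z, hz.1, fun i => (hgz i).1⟩
  refine h.exists_forall_add_mem (fun i => r • y i) hA hAfin ?_
  set β := ProbabilityTheory.cond volume
    (Metric.closedBall (0 : EuclideanSpace ℝ (Fin d)) t)
  have : IsProbabilityMeasure β := ProbabilityTheory.cond_isProbabilityMeasure_of_finite
    (Metric.measure_closedBall_pos volume _ ht0).ne' measure_closedBall_lt_top.ne
  have hβt : ∀ᵐ u ∂β, ‖u‖ ≤ t := by
    filter_upwards [ProbabilityTheory.ae_cond_mem (μ := volume)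
      (Metric.isClosed_closedBall (x := (0 : EuclideanSpace ℝ (Fin d))) (ε := t)).measurableSet]
      with u hu
    simpa using hu
  have hFint : ∫ z, A.indicator (fun _ => (1 : ℝ)) z = volume.real A := by
    simp [integral_indicator_const _ hA]
  have hdefect : ∀ i, volume.real A - ∫ z, A.indicator (fun _ => (1 : ℝ)) z *
      translateAverage (orbitMeasure μ φ (r • y i)) (A.indicator fun _ => 1) z ≤
        ((ρ + δ) * (1 + δ) / (ρ - δ) - (ρ + δ) + 3 / 2 * δ) * volume.real A := by
    intro i
    have := h.isProbabilityMeasure_orbitMeasure (r • y i)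
    have hi := integral_sub_integral_mul_translateAverage_le (ν := volume)
      (orbitMeasure μ φ (r • y i)) β (F := A.indicator fun _ => 1) (measurable_const.indicator hA)
      (indicator_nonneg fun _ _ => zero_le_one)
      (fun x => indicator_le_self' (fun _ _ => zero_le_one) x)
      ((integrable_indicator_iff hA).2 (integrableOn_const hAfin)) hδ ?_ (m := ρ + δ) ?_
      (p := p) (L := L) (b := t) (c := r * D) ht0.le (by positivity)
      (fun z hz => indicator_of_notMem (fun hzA => hz hzA.2) _) hβt ?_ measure_closedBall_lt_top.ne
    · rw [hFint, add_assoc] at hi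
      have h1 := hgrow L hL p
      have h2 : volume.real (Metric.closedBall p L) ≤ volume.real A / (ρ - δ) := by
        rw [le_div_iff₀ (by linarith), mul_comm]
        exact hp
      have h3 : (ρ + δ) * volume.real (Metric.closedBall p (L + (t + r * D))) ≤
          (ρ + δ) * ((1 + δ) * (volume.real A / (ρ - δ))) :=
        mul_le_mul_of_nonneg_left
          (h1.trans (mul_le_mul_of_nonneg_left h2 (by linarith))) (by linarith)
      refine hi.trans ?_
      have h4 : (ρ + δ) * ((1 + δ) * (volume.real A / (ρ - δ))) =
          (ρ + δ) * (1 + δ) / (ρ - δ) * volume.real A := by ring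
      linarith
    · filter_upwards [hβt] with u hu
      refine hsmooth (r • y i) u ?_ (hu.trans ?_)
      · rw [← norm_pos_iff, hw]
        exact mul_pos hr0 (hS.trans_le (hy i).1)
      · rw [hw, ht]
        have := (hy i).1
        gcongr
    · intro z
      refine translateAverage_cond_closedBall_le hA ht0 z (le_trans ?_ (hupper t htR z))
      exact measureReal_mono (inter_subset_inter_left _ inter_subset_left)
        (measure_ne_top_of_subset inter_subset_right measure_closedBall_lt_top.ne)
    · refine (ae_map_iff (h.measurable_apply _).aemeasurable
        (measurableSet_le measurable_norm measurable_const)).2 (.of_forall fun g => ?_)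
      rw [LinearIsometryEquiv.norm_map, hw]
      exact mul_le_mul_of_nonneg_left (hy i).2 hr0.le
  refine (Finset.sum_le_sum fun i _ => hdefect i).trans_lt ?_
  rw [Finset.sum_const, Finset.card_univ, Fintype.card_fin, nsmul_eq_mul, ← mul_assoc]
  push_cast
  exact mul_lt_of_lt_one_left hA0 hnum

end RotationAverages

/-- If `E ⊆ ℝ^d` (`d ≥ 2`) has upper Banach density greater than `(n-2)/(n-1)`, then there
is `R > 0` such that for every `n`-point pattern `P` (given by an injective `x : Fin n → ℝ^d`)
with `S ≤ sep P ≤ diam P ≤ D` and every `r ≥ R`, the set `E` contains a similar copy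
`r • Q(P) + z` of `P` for some rotation `Q ∈ SO(d)` and translation `z`. -/
theorem all_large_similar_copies (d n : ℕ) (hd : 2 ≤ d) (hn : 2 ≤ n)
    (S D : ℝ) (hS : 0 < S) (hSD : S ≤ D)
    (E : Set (EuclideanSpace ℝ (Fin d))) (hE : MeasurableSet E)
    (hρ : ((n : ENNReal) - 2) / ((n : ENNReal) - 1) < upperBanachDensity d E) :
    ∃ R > (0 : ℝ), ∀ x : Fin n → EuclideanSpace ℝ (Fin d), Function.Injective x →
      (∀ i j, i ≠ j → S ≤ dist (x i) (x j) ∧ dist (x i) (x j) ≤ D) →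
      ∀ r : ℝ, R ≤ r →
        ∃ (z : EuclideanSpace ℝ (Fin d))
          (Q : EuclideanSpace ℝ (Fin d) ≃ₗᵢ[ℝ] EuclideanSpace ℝ (Fin d)),
          IsRotation Q ∧ ∀ i, r • Q (x i) + z ∈ E := by
  obtain ⟨k, rfl⟩ := Nat.exists_eq_add_of_le' hn
  have hk : (((k + 2 : ℕ) : ENNReal) - 2) / (((k + 2 : ℕ) : ENNReal) - 1) =
      ENNReal.ofReal (k / (k + 1)) := by
    have h2 : ((k + 2 : ℕ) : ENNReal) - 2 = (k : ℕ) := by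
      push_cast
      exact ENNReal.add_sub_cancel_right (by norm_num)
    have h1 : ((k + 2 : ℕ) : ENNReal) - 1 = ((k + 1 : ℕ) : ENNReal) := by
      rw [show k + 2 = k + 1 + 1 from rfl, Nat.cast_succ (k + 1)]
      exact ENNReal.add_sub_cancel_right ENNReal.one_ne_top
    rw [h1, h2, ENNReal.ofReal_div_of_pos (by positivity), ENNReal.ofReal_natCast,
      ← Nat.cast_succ, ENNReal.ofReal_natCast]
  rw [hk] at hρ
  obtain ⟨R, hR, hmain⟩ := exists_pos_forall_exists_add_mem (D := D) hd hS hE hρ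
  refine ⟨R, hR, fun x _ hx r hr => ?_⟩
  obtain ⟨Q, hQ, z, hz, hzQ⟩ := hmain (fun i => x i.succ - x 0)
    (fun i => by simpa [dist_eq_norm] using hx i.succ 0 (Fin.succ_ne_zero i)) r hr
  refine ⟨z - r • Q (x 0), Q, hQ, fun i => ?_⟩
  refine Fin.cases ?_ (fun i => ?_) i
  · simpa using hz
  · convert hzQ i using 1
    rw [map_smul, map_sub, smul_sub]
    abel
end

section
/- Let d ≥ 2 and n ≥ 2 be integers, let E ⊆ ℝ^d be Lebesgue-measurable, and let P = {x_0, …, x_{n−1}} ⊆ ℝ^d be a set of n distinct points. Write r_i := ‖x_i − x_0‖ > 0 for 1 ≤ i ≤ n−1. Suppose x_0 ∈ E and 𝓗^{d−1}(E ∩ S_{r_i}(x_0)) > ((n−2)/(n−1)) · 𝓗^{d−1}(S_{r_i}) for all 1 ≤ i ≤ n−1. Then there exists a rotation Q ∈ SO(d) such that Q(P − x_0) + x_0 ⊆ E, i.e., P may be rotated about x_0 so that all its points lie in E. -/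
open MeasureTheory

section InvariantMeasure

variable {G X : Type*} [Group G] [MulAction G X] [MeasurableSpace G] [MeasurableSpace X]

/-- If a probability measure `μ` on `G` is left invariant and `ν` is a finite `G`-invariant measure
concentrated on a set on which `G` acts transitively, then the image of `μ` under an orbit map
is the normalisation of `ν`. -/
theorem measure_inv_smul_mem_mul_univ [MeasurableMul G] (μ : Measure G) [IsProbabilityMeasure μ]
    [μ.IsMulLeftInvariant] (ν : Measure X) [IsFiniteMeasure ν] [SMulInvariantMeasure G X ν]
    (hsmul : Measurable fun p : G × X => p.1⁻¹ • p.2) {S B : Set X} (hS : ∀ᵐ y ∂ν, y ∈ S)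
    (htrans : ∀ y ∈ S, ∀ z ∈ S, ∃ g : G, g • y = z) (hB : MeasurableSet B) {y : X}
    (hy : y ∈ S) :
    μ {g | g⁻¹ • y ∈ B} * ν Set.univ = ν B := by
  have hconst : ∀ᵐ z ∂ν, μ {g | g⁻¹ • z ∈ B} = μ {g | g⁻¹ • y ∈ B} := by
    filter_upwards [hS] with z hz
    obtain ⟨h, rfl⟩ := htrans y hy z hz
    rw [← measure_preimage_mul μ h⁻¹ {g | g⁻¹ • y ∈ B}]
    congr 1
    ext g
    simp [mul_smul]
  have hmeas : MeasurableSet ((fun p : G × X => p.1⁻¹ • p.2) ⁻¹' B) := hsmul hB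
  calc μ {g | g⁻¹ • y ∈ B} * ν Set.univ
      = ∫⁻ z, μ {g | g⁻¹ • z ∈ B} ∂ν := by
        rw [lintegral_congr_ae hconst, lintegral_const]
    _ = (μ.prod ν) ((fun p : G × X => p.1⁻¹ • p.2) ⁻¹' B) :=
        (Measure.prod_apply_symm hmeas).symm
    _ = ∫⁻ g, ν ((fun z => g⁻¹ • z) ⁻¹' B) ∂μ := Measure.prod_apply hmeas
    _ = ν B := by simp [measure_preimage_smul_of_nullMeasurableSet ν hB.nullMeasurableSet]

end InvariantMeasure

/-- Finitely many events, each of probability greater than `(m - 1) / m` where `m` is their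
number, have a common point. -/
theorem exists_forall_mem_of_ofReal_lt_measure {Ω ι : Type*} [MeasurableSpace Ω] (μ : Measure Ω)
    [IsProbabilityMeasure μ] (s : Finset ι) {A : ι → Set Ω} (hA : ∀ i ∈ s, MeasurableSet (A i))
    (h : ∀ i ∈ s, ENNReal.ofReal (((s.card : ℝ) - 1) / s.card) < μ (A i)) :
    ∃ ω, ∀ i ∈ s, ω ∈ A i := by
  rcases s.eq_empty_or_nonempty with rfl | hs
  · obtain ⟨ω⟩ := nonempty_of_isProbabilityMeasure μ
    exact ⟨ω, by simp⟩
  have hcard : (0 : ℝ) < s.card := by exact_mod_cast hs.card_pos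
  have hcompl : ∀ i ∈ s, μ.real (A i)ᶜ < 1 / s.card := by
    intro i hi
    rw [probReal_compl_eq_one_sub (hA i hi)]
    have h1 : ((s.card : ℝ) - 1) / s.card < μ.real (A i) :=
      (ENNReal.ofReal_lt_iff_lt_toReal
        (div_nonneg (sub_nonneg.2 (by exact_mod_cast hs.card_pos)) hcard.le)
        (measure_ne_top _ _)).1 (h i hi)
    rw [sub_div, div_self hcard.ne'] at h1
    linarith
  by_contra! hne
  have huniv : (⋃ i ∈ s, (A i)ᶜ) = Set.univ := by
    ext ω
    simpa using hne ω
  have hle : (1 : ℝ) ≤ ∑ i ∈ s, μ.real (A i)ᶜ := by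
    rw [← probReal_univ (μ := μ), ← huniv]
    exact measureReal_biUnion_finset_le s _
  have hlt := Finset.sum_lt_sum_of_nonempty hs hcompl
  rw [Finset.sum_const, nsmul_eq_mul, mul_one_div, div_self hcard.ne'] at hlt
  exact hle.not_gt hlt

section SpecialOrthogonal

variable (V : Type*) [NormedAddCommGroup V] [InnerProductSpace ℝ V] [FiniteDimensional ℝ V]

/-- The special orthogonal group of a finite-dimensional real inner product space. -/
noncomputable def specialOrthogonal : Subgroup (unitary (V →L[ℝ] V)) :=
  ((LinearMap.det (M := V)).comp
    (((ContinuousLinearMap.toLinearMapRingHom : (V →L[ℝ] V) →+* (V →ₗ[ℝ] V)) :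
      (V →L[ℝ] V) →* (V →ₗ[ℝ] V)).comp
      (unitary (V →L[ℝ] V)).subtype)).ker

variable {V}

theorem mem_specialOrthogonal_iff {U : unitary (V →L[ℝ] V)} :
    U ∈ specialOrthogonal V ↔ LinearMap.det ((U : V →L[ℝ] V) : V →ₗ[ℝ] V) = 1 :=
  Iff.rfl

theorem specialOrthogonal.smul_eq_linearIsometryEquiv (g : specialOrthogonal V) (x : V) :
    g • x = Unitary.linearIsometryEquiv (g : unitary (V →L[ℝ] V)) x :=
  rfl

theorem specialOrthogonal.det_linearIsometryEquiv (g : specialOrthogonal V) :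
    LinearMap.det (Unitary.linearIsometryEquiv
      (g : unitary (V →L[ℝ] V))).toLinearEquiv.toLinearMap = 1 :=
  g.2

instance : IsIsometricSMul (specialOrthogonal V) V where
  isometry_smul g := (Unitary.linearIsometryEquiv (g : unitary (V →L[ℝ] V))).isometry

instance : ContinuousSMul (specialOrthogonal V) V where
  continuous_smul :=
    isBoundedBilinearMap_apply.continuous.comp
      ((continuous_subtype_val.comp (continuous_subtype_val.comp continuous_fst)).prodMk
        continuous_snd)

theorem isClosed_specialOrthogonal : IsClosed (specialOrthogonal V : Set (unitary (V →L[ℝ] V))) :=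
  isClosed_eq (f := fun U : unitary (V →L[ℝ] V) => (U : V →L[ℝ] V).det)
    (ContinuousLinearMap.continuous_det.comp continuous_subtype_val) continuous_const

instance : CompactSpace (unitary (V →L[ℝ] V)) := by
  refine isCompact_iff_compactSpace.1
    ((isCompact_closedBall (0 : V →L[ℝ] V) 1).of_isClosed_subset isClosed_unitary ?_)
  intro U hU
  rw [mem_closedBall_zero_iff]
  exact (Unitary.linearIsometryEquiv ⟨U, hU⟩).toLinearIsometry.norm_toContinuousLinearMap_le

instance : CompactSpace (specialOrthogonal V) :=
  isCompact_iff_compactSpace.1 isClosed_specialOrthogonal.isCompact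

theorem det_reflection_orthogonal_span_singleton {v : V} (hv : v ≠ 0) :
    LinearMap.det ((ℝ ∙ v)ᗮ.reflection.toLinearEquiv : V →ₗ[ℝ] V) = -1 := by
  rw [Submodule.det_reflection, Submodule.orthogonal_orthogonal, finrank_span_singleton hv,
    pow_one]

/-- In dimension at least two, the special orthogonal group acts transitively on spheres. -/
theorem exists_specialOrthogonal_smul_eq (hV : 2 ≤ Module.finrank ℝ V) {u v : V}
    (huv : ‖u‖ = ‖v‖) : ∃ g : specialOrthogonal V, g • u = v := by
  rcases eq_or_ne u v with rfl | hne
  · exact ⟨1, one_smul _ _⟩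
  obtain ⟨w, hw, hw0⟩ : ∃ w ∈ (ℝ ∙ u)ᗮ, w ≠ 0 := by
    refine Submodule.exists_mem_ne_zero_of_ne_bot fun hbot => ?_
    have h1 := (ℝ ∙ u).finrank_add_finrank_orthogonal
    rw [hbot, finrank_bot] at h1
    have h2 := finrank_span_le_card (R := ℝ) ({u} : Set V)
    rw [Set.toFinset_singleton, Finset.card_singleton] at h2
    omega
  let e : V ≃ₗᵢ[ℝ] V := (ℝ ∙ w)ᗮ.reflection.trans (ℝ ∙ (u - v))ᗮ.reflection
  have hdet : LinearMap.det (e.toLinearEquiv : V →ₗ[ℝ] V) = 1 := by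
    have : (e.toLinearEquiv : V →ₗ[ℝ] V) = ((ℝ ∙ (u - v))ᗮ.reflection.toLinearEquiv : V →ₗ[ℝ] V) ∘ₗ
        ((ℝ ∙ w)ᗮ.reflection.toLinearEquiv : V →ₗ[ℝ] V) := rfl
    rw [this, LinearMap.det_comp, det_reflection_orthogonal_span_singleton hw0,
      det_reflection_orthogonal_span_singleton (sub_ne_zero.2 hne)]
    norm_num
  refine ⟨⟨Unitary.linearIsometryEquiv.symm e, mem_specialOrthogonal_iff.2 hdet⟩, ?_⟩
  have hu : (ℝ ∙ w)ᗮ.reflection u = u := by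
    refine Submodule.reflection_mem_subspace_eq_self ?_
    rw [Submodule.mem_orthogonal_singleton_iff_inner_left]
    exact Submodule.mem_orthogonal_singleton_iff_inner_right.1 hw
  change (ℝ ∙ (u - v))ᗮ.reflection ((ℝ ∙ w)ᗮ.reflection u) = v
  rw [hu, Submodule.reflection_sub huv]

variable [MeasurableSpace V] [BorelSpace V]

instance (s r : ℝ) : SMulInvariantMeasure (specialOrthogonal V) V
    ((μH[s] : Measure V).restrict (Metric.sphere 0 r)) where
  measure_preimage_smul g B hB := by
    rw [Measure.restrict_apply hB, Measure.restrict_apply (measurable_const_smul g hB)]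
    have hpre : (fun x => g • x) ⁻¹' B ∩ Metric.sphere 0 r =
        (fun x => g • x) ⁻¹' (B ∩ Metric.sphere 0 r) := by
      ext x
      simp [specialOrthogonal.smul_eq_linearIsometryEquiv]
    rw [hpre]
    exact (Unitary.linearIsometryEquiv
      (g : unitary (V →L[ℝ] V))).toIsometryEquiv.hausdorffMeasure_preimage s _

/-- If for each `i` in a set of `m` indices `B i` occupies a proportion greater than `(m - 1) / m`
of the sphere about `0` through `v i`, then a single rotation moves every `v i` into `B i`. -/
theorem exists_specialOrthogonal_forall_smul_mem {ι : Type*} (hV : 2 ≤ Module.finrank ℝ V) (s : ℝ)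
    (t : Finset ι) (v : ι → V) (B : ι → Set V) (hB : ∀ i ∈ t, MeasurableSet (B i))
    (h : ∀ i ∈ t, ENNReal.ofReal (((t.card : ℝ) - 1) / t.card) *
      μH[s] (Metric.sphere (0 : V) ‖v i‖) < μH[s] (B i ∩ Metric.sphere 0 ‖v i‖)) :
    ∃ g : specialOrthogonal V, ∀ i ∈ t, g • v i ∈ B i := by
  rcases le_or_gt t.card 1 with ht | ht
  · rcases t.eq_empty_or_nonempty with rfl | ⟨i, hi⟩
    · exact ⟨1, by simp⟩
    obtain ⟨w, hwB, hw⟩ : (B i ∩ Metric.sphere 0 ‖v i‖).Nonempty :=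
      nonempty_of_measure_ne_zero (zero_le.trans_lt (h i hi)).ne'
    obtain ⟨g, hg⟩ := exists_specialOrthogonal_smul_eq hV (mem_sphere_zero_iff_norm.1 hw).symm
    refine ⟨g, fun j hj => ?_⟩
    rw [Finset.card_le_one.1 ht j hj i hi, hg]
    exact hwB
  let _ : MeasurableSpace (specialOrthogonal V) := borel _
  have : BorelSpace (specialOrthogonal V) := ⟨rfl⟩
  let μ : Measure (specialOrthogonal V) := Measure.haarMeasure ⊤
  have : IsProbabilityMeasure μ := ⟨Measure.haarMeasure_self⟩
  have hcont : Continuous fun p : specialOrthogonal V × V => p.1⁻¹ • p.2 := by fun_prop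
  obtain ⟨g, hg⟩ := exists_forall_mem_of_ofReal_lt_measure μ t
    (A := fun i => {g | g⁻¹ • v i ∈ B i})
    (fun i hi => (hcont.comp (continuous_id.prodMk continuous_const)).measurable (hB i hi)) (by
      intro i hi
      have ht' : (1 : ℝ) < t.card := by exact_mod_cast ht
      have hfin : μH[s] (Metric.sphere (0 : V) ‖v i‖) ≠ ⊤ := by
        intro htop
        have hc : ENNReal.ofReal (((t.card : ℝ) - 1) / t.card) ≠ 0 :=
          (ENNReal.ofReal_pos.2 (div_pos (by linarith) (by linarith))).ne'
        exact not_top_lt ((ENNReal.mul_top hc ▸ htop ▸ h i hi :))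
      have : IsFiniteMeasure ((μH[s] : Measure V).restrict (Metric.sphere 0 ‖v i‖)) :=
        isFiniteMeasure_restrict.2 hfin
      have key := measure_inv_smul_mem_mul_univ μ
        ((μH[s] : Measure V).restrict (Metric.sphere 0 ‖v i‖)) hcont.measurable
        (ae_restrict_mem Metric.isClosed_sphere.measurableSet)
        (fun y hy z hz => exists_specialOrthogonal_smul_eq hV
          ((mem_sphere_zero_iff_norm.1 hy).trans (mem_sphere_zero_iff_norm.1 hz).symm))
        (hB i hi) (mem_sphere_zero_iff_norm.2 rfl)
      rw [Measure.restrict_apply_univ, Measure.restrict_apply (hB i hi)] at key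
      exact lt_of_mul_lt_mul_right' (key ▸ h i hi))
  exact ⟨g⁻¹, hg⟩

end SpecialOrthogonal

/-- Let `E ⊆ ℝ^d` be measurable and `P = {x_0, …, x_{n-1}}` a set of `n` distinct points
with `x_0 ∈ E`. If for each `i ≠ 0` the set `E` occupies a proportion greater than
`(n-2)/(n-1)` of the sphere centred at `x_0` of radius `‖x_i - x_0‖`, then there is a
rotation `Q ∈ SO(d)` with `Q(P - x_0) + x_0 ⊆ E`. -/
theorem rotation_lemma (d n : ℕ) (hd : 2 ≤ d) (hn : 2 ≤ n)
    (E : Set (EuclideanSpace ℝ (Fin d))) (hE : MeasurableSet E)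
    (x : Fin n → EuclideanSpace ℝ (Fin d)) (hx : Function.Injective x)
    (h0 : x ⟨0, by omega⟩ ∈ E)
    (hmes : ∀ i : Fin n, i ≠ ⟨0, by omega⟩ →
      ENNReal.ofReal (((n : ℝ) - 2) / ((n : ℝ) - 1)) *
          μH[(d : ℝ) - 1] (Metric.sphere (0 : EuclideanSpace ℝ (Fin d))
            (dist (x i) (x ⟨0, by omega⟩))) <
        μH[(d : ℝ) - 1]
          (E ∩ Metric.sphere (x ⟨0, by omega⟩) (dist (x i) (x ⟨0, by omega⟩)))) :
    ∃ Q : EuclideanSpace ℝ (Fin d) ≃ₗᵢ[ℝ] EuclideanSpace ℝ (Fin d),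
      IsRotation Q ∧ ∀ i : Fin n, Q (x i - x ⟨0, by omega⟩) + x ⟨0, by omega⟩ ∈ E := by
  have hn1 : ((Finset.univ.erase (⟨0, by omega⟩ : Fin n)).card : ℝ) = (n : ℝ) - 1 := by
    rw [Finset.card_erase_of_mem (Finset.mem_univ _), Finset.card_fin, Nat.cast_sub (by omega),
      Nat.cast_one]
  obtain ⟨g, hg⟩ := exists_specialOrthogonal_forall_smul_mem
    (V := EuclideanSpace ℝ (Fin d)) (by simpa using hd) ((d : ℝ) - 1)
    (Finset.univ.erase (⟨0, by omega⟩ : Fin n)) (fun i => x i - x ⟨0, by omega⟩)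
    (fun _ => (· + x ⟨0, by omega⟩) ⁻¹' E) (fun _ _ => measurable_add_const _ hE) (by
      intro i hi
      have hpre : (· + x ⟨0, by omega⟩) ⁻¹' E ∩ Metric.sphere 0 ‖x i - x ⟨0, by omega⟩‖ =
          IsometryEquiv.addRight (x ⟨0, by omega⟩) ⁻¹'
            (E ∩ Metric.sphere (x ⟨0, by omega⟩) (dist (x i) (x ⟨0, by omega⟩))) := by
        ext y
        simp [dist_eq_norm]
      rw [hpre, IsometryEquiv.hausdorffMeasure_preimage, ← dist_eq_norm, hn1,
        show (n : ℝ) - 1 - 1 = n - 2 by ring]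
      exact hmes i (Finset.ne_of_mem_erase hi))
  refine ⟨Unitary.linearIsometryEquiv g.1, specialOrthogonal.det_linearIsometryEquiv g,
    fun i => ?_⟩
  by_cases hi : i = ⟨0, by omega⟩
  · simpa [hi] using h0
  · exact hg i (Finset.mem_erase.2 ⟨hi, Finset.mem_univ i⟩)
end

section
/- Let d ≥ 2, r > 0, and let v ∈ ℝ^d satisfy 0 < ‖v‖ < 2r. Then lim_{δ→0+} δ^{−2} · 𝓛^d(A_{r,r+δ}(0) ∩ A_{r,r+δ}(v)) = K_r^{(d)}(v), where K_r^{(d)}(v) = 2 r² π^{(d−1)/2} (r² − ‖v‖²/4)^{(d−3)/2} / (Γ((d−1)/2) · ‖v‖). Moreover if ‖v‖ > 2r then δ^{−2} · 𝓛^d(A_{r,r+δ}(0) ∩ A_{r,r+δ}(v)) = 0 for all sufficiently small δ > 0. -/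
open MeasureTheory Filter

/-- The annulus `A_{r₁,r₂}(x) = B_{r₂}(x) \ B_{r₁}(x)` in `ℝ^d`. -/
def annulus {d : ℕ} (x : EuclideanSpace ℝ (Fin d)) (r₁ r₂ : ℝ) :
    Set (EuclideanSpace ℝ (Fin d)) :=
  Metric.closedBall x r₂ \ Metric.closedBall x r₁

/-- The tent function `u ↦ max 0 (ε - 2ℓ|u|)` has integral `ε² / (2ℓ)`. -/
lemma lintegral_tent {ε l : ℝ} (hε : 0 < ε) (hl : 0 < l) :
    ∫⁻ u : ℝ, ENNReal.ofReal (max 0 (ε - 2 * l * |u|)) = ENNReal.ofReal (ε ^ 2 / (2 * l)) := by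
  have hint : Integrable (fun u : ℝ => max 0 (ε - 2 * l * |u|)) := by
    refine Continuous.integrable_of_hasCompactSupport (by fun_prop) ?_
    refine HasCompactSupport.of_support_subset_isCompact (isCompact_Icc (a := -(ε / (2 * l)))
      (b := ε / (2 * l))) ?_
    intro u hu
    rw [Set.mem_Icc, ← abs_le, le_div_iff₀ (by positivity)]
    by_contra! h
    exact hu (max_eq_left (by linarith))
  rw [← ofReal_integral_eq_lintegral_ofReal hint (ae_of_all _ fun _ => le_max_left _ _)]
  congr 1
  rw [integral_comp_abs (f := fun u => max 0 (ε - 2 * l * u))]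
  have ha : 0 ≤ ε / (2 * l) := by positivity
  have h1 : ∫ u in Set.Ioi (0 : ℝ), max 0 (ε - 2 * l * u)
      = ∫ u in Set.Ioc (0 : ℝ) (ε / (2 * l)), max 0 (ε - 2 * l * u) := by
    refine setIntegral_eq_of_subset_of_forall_sdiff_eq_zero measurableSet_Ioi
      Set.Ioc_subset_Ioi_self ?_
    rintro u ⟨h0, h⟩
    have : ε / (2 * l) < u := by
      by_contra! h'
      exact h ⟨h0, h'⟩
    rw [div_lt_iff₀ (by positivity)] at this
    exact max_eq_left (by linarith)
  have h2 : ∫ u in Set.Ioc (0 : ℝ) (ε / (2 * l)), max 0 (ε - 2 * l * u)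
      = ∫ u in Set.Ioc (0 : ℝ) (ε / (2 * l)), (ε - 2 * l * u) := by
    refine setIntegral_congr_fun measurableSet_Ioc fun u hu => ?_
    have := hu.2
    rw [le_div_iff₀ (by positivity)] at this
    exact max_eq_right (by linarith)
  rw [h1, h2, ← intervalIntegral.integral_of_le ha, intervalIntegral.integral_sub
    intervalIntegrable_const (Continuous.intervalIntegrable (by fun_prop) _ _),
    intervalIntegral.integral_const_mul, intervalIntegral.integral_const, integral_id]
  simp only [smul_eq_mul]
  field_simp
  ring

/-- The volume of a spherical shell, in terms of the squares of its radii. -/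
lemma volume_shell {n : ℕ} (hn : 0 < n) {a b : ℝ} (ha : 0 ≤ a) (hab : a ≤ b) :
    volume {y : EuclideanSpace ℝ (Fin n) | a < ‖y‖ ^ 2 ∧ ‖y‖ ^ 2 ≤ b} =
      ENNReal.ofReal (√Real.pi ^ n / Real.Gamma (n / 2 + 1) *
        (b ^ ((n : ℝ) / 2) - a ^ ((n : ℝ) / 2))) := by
  have : Nonempty (Fin n) := ⟨⟨0, hn⟩⟩
  have hb := ha.trans hab
  have hset : {y : EuclideanSpace ℝ (Fin n) | a < ‖y‖ ^ 2 ∧ ‖y‖ ^ 2 ≤ b} =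
      Metric.closedBall 0 (√b) \ Metric.closedBall 0 (√a) := by
    ext y
    simp only [Set.mem_ofPred_eq, Set.mem_sdiff, mem_closedBall_zero_iff, not_le]
    rw [Real.le_sqrt (norm_nonneg _) hb, Real.sqrt_lt ha (norm_nonneg _)]
    exact and_comm
  have hpow : ∀ c : ℝ, 0 ≤ c → √c ^ n = c ^ ((n : ℝ) / 2) := fun c hc => by
    rw [Real.sqrt_eq_rpow, ← Real.rpow_natCast, ← Real.rpow_mul hc]
    ring_nf
  have hω : 0 ≤ √Real.pi ^ n / Real.Gamma (n / 2 + 1) := by positivity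
  rw [hset, measure_sdiff (Metric.closedBall_subset_closedBall (Real.sqrt_le_sqrt hab))
    measurableSet_closedBall.nullMeasurableSet measure_closedBall_lt_top.ne,
    EuclideanSpace.volume_closedBall, EuclideanSpace.volume_closedBall, Fintype.card_fin,
    ← ENNReal.ofReal_pow (Real.sqrt_nonneg _), ← ENNReal.ofReal_pow (Real.sqrt_nonneg _),
    ← ENNReal.ofReal_mul (by positivity), ← ENNReal.ofReal_mul (by positivity),
    ← ENNReal.ofReal_sub _ (by positivity), hpow a ha, hpow b hb]
  ring_nf

/-- Orthogonal coordinates whose first axis points along `v`. -/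
lemma exists_measurePreserving_coordinates {n : ℕ} {v : EuclideanSpace ℝ (Fin (n + 1))}
    (hv : v ≠ 0) :
    ∃ φ : ℝ × EuclideanSpace ℝ (Fin n) → EuclideanSpace ℝ (Fin (n + 1)), MeasurePreserving φ ∧
      ∀ p, ‖φ p‖ ^ 2 = p.1 ^ 2 + ‖p.2‖ ^ 2 ∧ ‖φ p - v‖ ^ 2 = (p.1 - ‖v‖) ^ 2 + ‖p.2‖ ^ 2 := by
  have hv' : ‖v‖ ≠ 0 := norm_ne_zero_iff.mpr hv
  obtain ⟨b, hb⟩ := Orthonormal.exists_orthonormalBasis_extension_of_card_eq (𝕜 := ℝ)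
    (ι := Fin (n + 1)) (E := EuclideanSpace ℝ (Fin (n + 1))) (by simp)
    (v := fun _ => ‖v‖⁻¹ • v) (s := {0}) (by
      rw [orthonormal_iff_ite]
      rintro ⟨i, hi⟩ ⟨j, hj⟩
      obtain rfl : i = 0 := hi
      obtain rfl : j = 0 := hj
      simp [norm_smul, hv'])
  have hb0 : b 0 = ‖v‖⁻¹ • v := hb 0 rfl
  have hvb : v = b.repr.symm (EuclideanSpace.single 0 ‖v‖) := by
    apply b.repr.injective
    have : v = ‖v‖ • b 0 := by rw [hb0, smul_inv_smul₀ hv']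
    rw [LinearIsometryEquiv.apply_symm_apply]
    conv_lhs => rw [this]
    ext i
    simp
  have hmp : MeasurePreserving (fun p : ℝ × EuclideanSpace ℝ (Fin n) =>
      b.repr.symm (WithLp.toLp 2
        ((MeasurableEquiv.piFinSuccAbove (fun _ : Fin (n + 1) => ℝ) 0).symm
          (p.1, WithLp.ofLp p.2)))) := by
    refine b.repr.symm.measurePreserving.comp ((PiLp.volume_preserving_toLp _).comp
      ((volume_preserving_piFinSuccAbove (fun _ : Fin (n + 1) => ℝ) 0).symm.comp ?_))
    exact (MeasurePreserving.id _).prod (PiLp.volume_preserving_ofLp _)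
  refine ⟨_, hmp, fun p => ⟨?_, ?_⟩⟩
  · rw [LinearIsometryEquiv.norm_map, EuclideanSpace.real_norm_sq_eq,
      EuclideanSpace.real_norm_sq_eq, Fin.sum_univ_succ]
    simp [MeasurableEquiv.piFinSuccAbove]
  · conv_lhs => rw [hvb, ← map_sub]
    rw [LinearIsometryEquiv.norm_map, EuclideanSpace.real_norm_sq_eq,
      EuclideanSpace.real_norm_sq_eq, Fin.sum_univ_succ]
    simp [MeasurableEquiv.piFinSuccAbove]

lemma mem_annulus_iff {d : ℕ} {x p : EuclideanSpace ℝ (Fin d)} {r₁ r₂ : ℝ} (h₁ : 0 ≤ r₁)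
    (h₂ : 0 ≤ r₂) : p ∈ annulus x r₁ r₂ ↔ r₁ ^ 2 < ‖p - x‖ ^ 2 ∧ ‖p - x‖ ^ 2 ≤ r₂ ^ 2 := by
  rw [annulus, Set.mem_sdiff, mem_closedBall_iff_norm, mem_closedBall_iff_norm, not_le,
    sq_lt_sq₀ h₁ (norm_nonneg _), sq_le_sq₀ (norm_nonneg _) h₂]
  exact and_comm

/-- The slice of the intersection of two annuli by the hyperplane at signed distance `u` from the
bisector of their centres. -/
def annuliSlice (n : ℕ) (r l ε u : ℝ) : Set (EuclideanSpace ℝ (Fin n)) :=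
  {y | (r ^ 2 < (u + l / 2) ^ 2 + ‖y‖ ^ 2 ∧ (u + l / 2) ^ 2 + ‖y‖ ^ 2 ≤ r ^ 2 + ε) ∧
    (r ^ 2 < (u - l / 2) ^ 2 + ‖y‖ ^ 2 ∧ (u - l / 2) ^ 2 + ‖y‖ ^ 2 ≤ r ^ 2 + ε)}

lemma annuliSlice_eq_shell {n : ℕ} {r l ε u : ℝ} (hl : 0 ≤ l) :
    annuliSlice n r l ε u = {y | r ^ 2 - l ^ 2 / 4 - u ^ 2 + l * |u| < ‖y‖ ^ 2 ∧
      ‖y‖ ^ 2 ≤ r ^ 2 - l ^ 2 / 4 - u ^ 2 + ε - l * |u|} := by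
  ext y
  simp only [annuliSlice, Set.mem_ofPred_eq]
  have h1 : l * u ≤ l * |u| := mul_le_mul_of_nonneg_left (le_abs_self u) hl
  have h2 : l * -u ≤ l * |u| := mul_le_mul_of_nonneg_left (neg_le_abs u) hl
  constructor
  · rintro ⟨⟨h3, h4⟩, h5, h6⟩
    rcases abs_choice u with h | h <;> rw [h] <;> constructor <;> nlinarith
  · rintro ⟨h3, h4⟩
    refine ⟨⟨?_, ?_⟩, ?_, ?_⟩ <;> nlinarith

lemma volume_annuliSlice_bounds {n : ℕ} (hn : 0 < n) {r l ε u ρ c η : ℝ} (hl : 0 < l)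
    (hε : 0 < ε) (hρ : ρ ≤ r ^ 2 - l ^ 2 / 4)
    (hερ : 3 / 2 * ε + (ε / (2 * l)) ^ 2 < ρ)
    (hc : ∀ x y, |x - (r ^ 2 - l ^ 2 / 4)| < ρ → |y - (r ^ 2 - l ^ 2 / 4)| < ρ →
      |x ^ ((n : ℝ) / 2) - y ^ ((n : ℝ) / 2) - c * (x - y)| ≤ η * |x - y|) :
    ENNReal.ofReal (√Real.pi ^ n / Real.Gamma (n / 2 + 1) * (c - η)) *
        ENNReal.ofReal (max 0 (ε - 2 * l * |u|)) ≤ volume (annuliSlice n r l ε u) ∧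
    volume (annuliSlice n r l ε u) ≤
      ENNReal.ofReal (√Real.pi ^ n / Real.Gamma (n / 2 + 1) * (c + η)) *
        ENNReal.ofReal (max 0 (ε - 2 * l * |u|)) := by
  rw [annuliSlice_eq_shell hl.le]
  rcases le_or_gt (ε - 2 * l * |u|) 0 with h | h
  · rw [max_eq_left h, ENNReal.ofReal_zero, mul_zero, mul_zero]
    refine ⟨zero_le, ?_⟩
    rw [nonpos_iff_eq_zero]
    convert measure_empty (μ := (volume : Measure (EuclideanSpace ℝ (Fin n))))
    rw [Set.eq_empty_iff_forall_notMem]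
    rintro y ⟨h1, h2⟩
    linarith
  · rw [max_eq_right h.le, ← ENNReal.ofReal_mul' h.le, ← ENNReal.ofReal_mul' h.le]
    set H := r ^ 2 - l ^ 2 / 4
    have hu : |u| < ε / (2 * l) := by
      rw [lt_div_iff₀ (by positivity)]
      linarith
    have hu2 : u ^ 2 ≤ (ε / (2 * l)) ^ 2 := by
      rw [← sq_abs]
      gcongr
    have hu0 : 0 ≤ l * |u| := by positivity
    have hα : |H - u ^ 2 + l * |u| - H| < ρ := by
      rw [abs_lt]
      constructor <;> nlinarith [sq_nonneg u]
    have hβ : |H - u ^ 2 + ε - l * |u| - H| < ρ := by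
      rw [abs_lt]
      constructor <;> nlinarith [sq_nonneg u]
    have hα0 : 0 ≤ H - u ^ 2 + l * |u| := by linarith [(abs_lt.mp hα).1]
    have hω : 0 ≤ √Real.pi ^ n / Real.Gamma (n / 2 + 1) := by positivity
    have key := hc _ _ hβ hα
    have hd : H - u ^ 2 + ε - l * |u| - (H - u ^ 2 + l * |u|) = ε - 2 * l * |u| := by ring
    rw [hd, abs_of_pos h, abs_le] at key
    rw [volume_shell hn hα0 (by linarith), mul_assoc _ (c - η), mul_assoc _ (c + η)]
    constructor <;> refine ENNReal.ofReal_le_ofReal (mul_le_mul_of_nonneg_left ?_ hω) <;> linarith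

lemma volume_annuli_inter_eq_lintegral {n : ℕ} {v : EuclideanSpace ℝ (Fin (n + 1))} (hv : v ≠ 0)
    {r δ : ℝ} (hr : 0 < r) (hδ : 0 < δ) :
    volume (annulus 0 r (r + δ) ∩ annulus v r (r + δ)) =
      ∫⁻ u, volume (annuliSlice n r ‖v‖ (2 * r * δ + δ ^ 2) u) := by
  obtain ⟨φ, hφ, hφv⟩ := exists_measurePreserving_coordinates hv
  have hmeas : MeasurableSet (annulus 0 r (r + δ) ∩ annulus v r (r + δ)) :=
    (measurableSet_closedBall.diff measurableSet_closedBall).inter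
      (measurableSet_closedBall.diff measurableSet_closedBall)
  rw [← hφ.measure_preimage hmeas.nullMeasurableSet, Measure.volume_eq_prod,
    Measure.prod_apply (hφ.measurable hmeas), ← lintegral_add_right_eq_self _ (‖v‖ / 2)]
  congr with u
  congr 1
  ext y
  have hR : (r + δ) ^ 2 = r ^ 2 + (2 * r * δ + δ ^ 2) := by ring
  have hu : u + ‖v‖ / 2 - ‖v‖ = u - ‖v‖ / 2 := by ring
  simp only [Set.mem_preimage, Set.mem_inter_iff, mem_annulus_iff hr.le (add_pos hr hδ).le,
    sub_zero, (hφv _).1, (hφv _).2, hR, hu]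
  rfl

lemma tendsto_volume_annuli_inter {n : ℕ} (hn : 0 < n) {v : EuclideanSpace ℝ (Fin (n + 1))}
    (hv : v ≠ 0) {r : ℝ} (hr : 0 < r) (hvr : ‖v‖ < 2 * r) :
    Tendsto (fun δ : ℝ => (volume (annulus 0 r (r + δ) ∩ annulus v r (r + δ))).toReal /
        (2 * r * δ + δ ^ 2) ^ 2)
      (nhdsWithin 0 (Set.Ioi 0))
      (nhds (√Real.pi ^ n / Real.Gamma (n / 2 + 1) *
        ((n : ℝ) / 2 * (r ^ 2 - ‖v‖ ^ 2 / 4) ^ ((n : ℝ) / 2 - 1)) / (2 * ‖v‖))) := by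
  have hl : 0 < ‖v‖ := norm_pos_iff.mpr hv
  set H := r ^ 2 - ‖v‖ ^ 2 / 4 with hH
  have hH0 : 0 < H := by
    rw [hH]
    nlinarith
  set c := (n : ℝ) / 2 * H ^ ((n : ℝ) / 2 - 1)
  set ω := √Real.pi ^ n / Real.Gamma (n / 2 + 1) with hωdef
  have hω : 0 < ω := by positivity
  rw [Metric.tendsto_nhds]
  intro κ hκ
  set η := κ * ‖v‖ / ω with hη
  have hη0 : 0 < η := by positivity
  have hstrict := (Real.hasStrictDerivAt_rpow_const_of_ne hH0.ne' ((n : ℝ) / 2)).isLittleO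
  have hev := Asymptotics.isLittleO_iff.mp hstrict hη0
  obtain ⟨ρ₀, hρ₀, hball⟩ := Metric.eventually_nhds_iff.mp hev
  set ρ := min ρ₀ H
  have hρ : 0 < ρ := lt_min hρ₀ hH0
  have hc : ∀ x y, |x - H| < ρ → |y - H| < ρ →
      |x ^ ((n : ℝ) / 2) - y ^ ((n : ℝ) / 2) - c * (x - y)| ≤ η * |x - y| := by
    intro x y hx hy
    have := @hball (x, y) (by
      rw [Prod.dist_eq]
      exact max_lt (hx.trans_le (min_le_left _ _)) (hy.trans_le (min_le_left _ _)))
    simpa [mul_comm] using this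
  have hsmall : ∀ᶠ δ in nhdsWithin (0 : ℝ) (Set.Ioi 0),
      3 / 2 * (2 * r * δ + δ ^ 2) + ((2 * r * δ + δ ^ 2) / (2 * ‖v‖)) ^ 2 < ρ := by
    have hcont : Continuous fun δ : ℝ =>
        3 / 2 * (2 * r * δ + δ ^ 2) + ((2 * r * δ + δ ^ 2) / (2 * ‖v‖)) ^ 2 := by fun_prop
    exact nhdsWithin_le_nhds (hcont.continuousAt.eventually_lt_const (by simpa using hρ))
  filter_upwards [hsmall, self_mem_nhdsWithin] with δ hδρ hδ
  have hδ : 0 < δ := hδ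
  set ε := 2 * r * δ + δ ^ 2 with hεdef
  have hε : 0 < ε := by positivity
  set V := volume (annulus 0 r (r + δ) ∩ annulus v r (r + δ)) with hV
  have hslice := fun u => volume_annuliSlice_bounds (u := u) hn hl hε (min_le_right _ _) hδρ hc
  have hlow : ENNReal.ofReal (ω * (c - η) * (ε ^ 2 / (2 * ‖v‖))) ≤ V := by
    rw [ENNReal.ofReal_mul' (by positivity), ← lintegral_tent hε hl,
      ← lintegral_const_mul' _ _ ENNReal.ofReal_ne_top, hV, volume_annuli_inter_eq_lintegral hv hr hδ]
    exact lintegral_mono fun u => (hslice u).1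
  have hup : V ≤ ENNReal.ofReal (ω * (c + η) * (ε ^ 2 / (2 * ‖v‖))) := by
    rw [ENNReal.ofReal_mul' (by positivity), ← lintegral_tent hε hl,
      ← lintegral_const_mul' _ _ ENNReal.ofReal_ne_top, hV, volume_annuli_inter_eq_lintegral hv hr hδ]
    exact lintegral_mono fun u => (hslice u).2
  have hc0 : 0 < c := by positivity
  have hVtop : V ≠ ⊤ := (hup.trans_lt ENNReal.ofReal_lt_top).ne
  have hlow' := (ENNReal.ofReal_le_iff_le_toReal hVtop).mp hlow
  have hup' := ENNReal.toReal_le_of_le_ofReal (by positivity) hup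
  have hωη : ω * η = κ * ‖v‖ := by
    rw [hη]
    field_simp
  have h1 : ω * (c - η) * (ε ^ 2 / (2 * ‖v‖)) = (ω * c / (2 * ‖v‖) - κ / 2) * ε ^ 2 := by
    rw [mul_sub, hωη]
    field_simp
  have h2 : ω * (c + η) * (ε ^ 2 / (2 * ‖v‖)) = (ω * c / (2 * ‖v‖) + κ / 2) * ε ^ 2 := by
    rw [mul_add, hωη]
    field_simp
  rw [h1, ← le_div_iff₀ (by positivity)] at hlow'
  rw [h2, ← div_le_iff₀ (by positivity)] at hup'
  rw [Real.dist_eq, abs_lt]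
  constructor <;> linarith

/-- The constant in the limit, rewritten in terms of the kernel. -/
lemma shell_constant_eq_kernel {n : ℕ} (hn : 0 < n) (r l H : ℝ) :
    √Real.pi ^ n / Real.Gamma (n / 2 + 1) * ((n : ℝ) / 2 * H ^ ((n : ℝ) / 2 - 1)) / (2 * l) *
        (2 * r) ^ 2 =
      2 * r ^ 2 * Real.pi ^ ((((n + 1 : ℕ) : ℝ) - 1) / 2) * H ^ ((((n + 1 : ℕ) : ℝ) - 3) / 2) /
        (Real.Gamma ((((n + 1 : ℕ) : ℝ) - 1) / 2) * l) := by
  have hn' : (n : ℝ) / 2 ≠ 0 := by positivity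
  have hΓ : Real.Gamma ((n : ℝ) / 2) ≠ 0 := (Real.Gamma_pos_of_pos (by positivity)).ne'
  have h1 : (((n + 1 : ℕ) : ℝ) - 1) / 2 = n / 2 := by push_cast; ring
  have h2 : (((n + 1 : ℕ) : ℝ) - 3) / 2 = (n : ℝ) / 2 - 1 := by push_cast; ring
  have h3 : √Real.pi ^ n = Real.pi ^ ((n : ℝ) / 2) := by
    rw [Real.sqrt_eq_rpow, ← Real.rpow_natCast, ← Real.rpow_mul Real.pi_pos.le]
    ring_nf
  rw [h1, h2, h3, Real.Gamma_add_one hn']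
  rcases eq_or_ne l 0 with rfl | hl
  · simp
  · field_simp

/-- For `0 < ‖v‖ < 2r`, `δ⁻² 𝓛^d(A_{r,r+δ}(0) ∩ A_{r,r+δ}(v))` converges, as `δ → 0⁺`, to
`K_r^{(d)}(v) = 2r²π^{(d-1)/2}(r² - ‖v‖²/4)^{(d-3)/2} / (Γ((d-1)/2)‖v‖)`; and for
`‖v‖ > 2r` it equals `0` for all sufficiently small `δ > 0`. -/
theorem annuli_intersection_limit (d : ℕ) (hd : 2 ≤ d) (r : ℝ) (hr : 0 < r)
    (v : EuclideanSpace ℝ (Fin d)) :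
    ((0 < ‖v‖ ∧ ‖v‖ < 2 * r) →
      Filter.Tendsto
        (fun δ : ℝ =>
          (volume (annulus 0 r (r + δ) ∩ annulus v r (r + δ))).toReal / δ ^ 2)
        (nhdsWithin 0 (Set.Ioi 0))
        (nhds (2 * r ^ 2 * Real.pi ^ (((d : ℝ) - 1) / 2) *
          (r ^ 2 - ‖v‖ ^ 2 / 4) ^ (((d : ℝ) - 3) / 2) /
            (Real.Gamma (((d : ℝ) - 1) / 2) * ‖v‖)))) ∧
    (2 * r < ‖v‖ →
      ∀ᶠ δ in nhdsWithin (0 : ℝ) (Set.Ioi 0),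
        (volume (annulus 0 r (r + δ) ∩ annulus v r (r + δ))).toReal / δ ^ 2 = 0) := by
  refine ⟨fun ⟨hv, hvr⟩ => ?_, fun hvr => ?_⟩
  · obtain ⟨n, rfl⟩ : ∃ n, d = n + 1 := ⟨d - 1, by omega⟩
    have hn : 0 < n := by omega
    have hratio : Tendsto (fun δ : ℝ => (2 * r + δ) ^ 2) (nhdsWithin 0 (Set.Ioi 0))
        (nhds ((2 * r) ^ 2)) := by
      have hcont : Continuous fun δ : ℝ => (2 * r + δ) ^ 2 := by fun_prop
      simpa using (hcont.tendsto 0).mono_left nhdsWithin_le_nhds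
    have hlim := (tendsto_volume_annuli_inter hn (norm_pos_iff.mp hv) hr hvr).mul hratio
    rw [shell_constant_eq_kernel hn] at hlim
    refine hlim.congr' ?_
    filter_upwards [self_mem_nhdsWithin] with δ hδ
    have hδ : 0 < δ := hδ
    have hfac : 2 * r * δ + δ ^ 2 = δ * (2 * r + δ) := by ring
    have hne : 2 * r + δ ≠ 0 := by positivity
    rw [hfac]
    field_simp
  · have hev : ∀ᶠ δ in nhdsWithin (0 : ℝ) (Set.Ioi 0), δ < (‖v‖ - 2 * r) / 2 :=
      nhdsWithin_le_nhds (eventually_lt_nhds (by linarith))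
    filter_upwards [hev] with δ hδ
    have hempty : annulus 0 r (r + δ) ∩ annulus v r (r + δ) = ∅ := by
      refine Set.disjoint_iff_inter_eq_empty.mp (Disjoint.mono Set.sdiff_subset Set.sdiff_subset
        (Metric.closedBall_disjoint_closedBall ?_))
      rw [dist_zero_left]
      linarith
    rw [hempty, measure_empty, ENNReal.toReal_zero, zero_div]
end
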